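/- arXiv:1701.03289 — 3 statements merged into one kernel-verified Lean document; each statement's English description precedes it below -/
import Mathlib

section
/- For every z in ℂ \ [-1,1], ∫_{-1}^{1} 1/(√(1-λ²) (z - λ)) dλ = π / ((z-1)^{1/2} (z+1)^{1/2}), where the square roots are taken with the principal branch. -/
open Complex

lemma aux_sqrt (u : ℂ) (hu : u ≠ 0) :
    (u ^ ((1 : ℂ) / 2)) ^ 2 = u ∧ 0 ≤ (u ^ ((1 : ℂ) / 2)).re ∧
      ((u ^ ((1 : ℂ) / 2)).re = 0 → 0 < (u ^ ((1 : ℂ) / 2)).im) := by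
  have h1 := Complex.neg_pi_lt_arg u
  have h2 := Complex.arg_le_pi u
  have hre : (u ^ ((1 : ℂ) / 2)).re = Real.exp (Real.log ‖u‖ / 2) * Real.cos (u.arg / 2) := by
    rw [Complex.cpow_def_of_ne_zero hu, Complex.exp_re]
    have e1 : (Complex.log u * (1 / 2)).re = Real.log ‖u‖ / 2 := by
      simp [Complex.mul_re, Complex.log_re]; ring
    have e2 : (Complex.log u * (1 / 2)).im = u.arg / 2 := by
      simp [Complex.mul_im, Complex.log_im]; ring
    rw [e1, e2]
  have him : (u ^ ((1 : ℂ) / 2)).im = Real.exp (Real.log ‖u‖ / 2) * Real.sin (u.arg / 2) := by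
    rw [Complex.cpow_def_of_ne_zero hu, Complex.exp_im]
    have e1 : (Complex.log u * (1 / 2)).re = Real.log ‖u‖ / 2 := by
      simp [Complex.mul_re, Complex.log_re]; ring
    have e2 : (Complex.log u * (1 / 2)).im = u.arg / 2 := by
      simp [Complex.mul_im, Complex.log_im]; ring
    rw [e1, e2]
  refine ⟨?_, ?_, ?_⟩
  · rw [← Complex.cpow_nat_mul]; norm_num
  · rw [hre]
    exact mul_nonneg (Real.exp_pos _).le
      (Real.cos_nonneg_of_neg_pi_div_two_le_of_le (by linarith) (by linarith))
  · intro h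
    rw [hre] at h
    rw [him]
    rcases h2.lt_or_eq with h3 | h3
    · have : 0 < Real.cos (u.arg / 2) :=
        Real.cos_pos_of_mem_Ioo ⟨by linarith, by linarith⟩
      have := mul_pos (Real.exp_pos (Real.log ‖u‖ / 2)) this
      linarith
    · rw [h3, Real.sin_pi_div_two]
      simpa using Real.exp_pos _

lemma aux_re (z a b : ℂ) (hz : z ∉ (fun x : ℝ => (x : ℂ)) '' Set.Icc (-1 : ℝ) 1)
    (ha : a ^ 2 = z - 1) (hb : b ^ 2 = z + 1) (ha0 : 0 ≤ a.re) (hb0 : 0 ≤ b.re)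
    (ha1 : a.re = 0 → 0 < a.im) (hb1 : b.re = 0 → 0 < b.im) : 0 < (a / b).re := by
  have hbne : b ≠ 0 := by rintro rfl; simp at hb1
  rw [Complex.div_re, ← add_div]
  apply div_pos _ (Complex.normSq_pos.2 hbne)
  have e1 := congrArg Complex.re ha
  have e2 := congrArg Complex.im ha
  have e3 := congrArg Complex.re hb
  have e4 := congrArg Complex.im hb
  simp [pow_two] at e1 e2 e3 e4
  rcases ha0.lt_or_eq with ha2 | ha2 <;> rcases hb0.lt_or_eq with hb2 | hb2
  · have : 0 ≤ a.im * b.im := by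
      have h : a.re * a.im = b.re * b.im := by linarith
      have : 0 ≤ (a.re * b.re) * (a.im * b.im) := by
        have : (a.re * b.re) * (a.im * b.im) = (a.re * a.im) ^ 2 := by
          linear_combination (-(a.re * a.im)) * h
        rw [this]; positivity
      exact nonneg_of_mul_nonneg_right this (by positivity)
    have := mul_pos ha2 hb2
    linarith
  · -- `b.re = 0`, so `z` is real, and `a` is real
    have hb3 := hb1 hb2.symm
    rw [← hb2] at e3 e4
    have : a.im = 0 := by
      have : a.re * a.im = 0 := by linarith
      rcases mul_eq_zero.1 this with h | h
      · linarith
      · exact h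
    rw [this] at e1
    nlinarith
  · have ha3 := ha1 ha2.symm
    rw [← ha2] at e1 e2
    have : b.im = 0 := by
      have : b.re * b.im = 0 := by linarith
      rcases mul_eq_zero.1 this with h | h
      · linarith
      · exact h
    rw [this] at e3
    exfalso
    apply hz
    refine ⟨z.re, ⟨by nlinarith, by nlinarith⟩, ?_⟩
    apply Complex.ext
    · simp
    · simp; linarith
  · have := mul_pos (ha1 ha2.symm) (hb1 hb2.symm)
    rw [← ha2]; linarith

lemma aux_int : IntervalIntegrable (fun x : ℝ => (Real.sqrt (1 - x ^ 2))⁻¹)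
    MeasureTheory.volume (-1) 1 := by
  apply intervalIntegral.intervalIntegrable_deriv_of_nonneg (g := Real.arcsin)
  · exact Real.continuous_arcsin.continuousOn
  · intro x hx
    rw [min_eq_left (by norm_num), max_eq_right (by norm_num)] at hx
    simpa using Real.hasDerivAt_arcsin (x := x) (by linarith [hx.1]) (by linarith [hx.2])
  · intro x hx
    positivity

lemma aux_deriv (w : ℂ) (x : ℝ) (hx : x ∈ Set.Ioo (-1 : ℝ) 1)
    (hs : (Real.sqrt (1 - x) : ℂ) + w * Real.sqrt (1 + x) ∈ Complex.slitPlane) :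
    HasDerivAt (fun x : ℝ => Complex.log ((Real.sqrt (1 - x) : ℂ) + w * Real.sqrt (1 + x)))
     (((-(1 / (2 * Real.sqrt (1 - x))) : ℂ) + w * (1 / (2 * Real.sqrt (1 + x)) : ℂ)) /
      ((Real.sqrt (1 - x) : ℂ) + w * Real.sqrt (1 + x))) x := by
  have h1 : HasDerivAt (fun x : ℝ => Real.sqrt (1 - x)) (-1 / (2 * Real.sqrt (1 - x))) x :=
    ((hasDerivAt_id x).const_sub 1).sqrt (by simp; linarith [hx.2])
  have h2 : HasDerivAt (fun x : ℝ => Real.sqrt (1 + x)) (1 / (2 * Real.sqrt (1 + x))) x :=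
    ((hasDerivAt_id x).const_add 1).sqrt (by simp; linarith [hx.1])
  have := (h1.ofReal_comp.add (h2.ofReal_comp.const_mul w)).clog_real hs
  refine HasDerivAt.congr_deriv this ?_
  simp only [Pi.add_apply]
  push_cast
  ring

/-- For `z ∈ ℂ \ [-1,1]`,
`∫_{-1}^1 1/(√(1-λ²) (z - λ)) dλ = π / ((z-1)^{1/2} (z+1)^{1/2})`
with principal branch square roots. -/
theorem cauchy_transform_arcsine (z : ℂ)
    (hz : z ∉ (fun x : ℝ => (x : ℂ)) '' Set.Icc (-1 : ℝ) 1) :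
    ∫ lam in (-1 : ℝ)..1,
        ((Real.sqrt (1 - lam ^ 2) : ℂ) * (z - (lam : ℂ)))⁻¹
      = (Real.pi : ℂ) / ((z - 1) ^ ((1 : ℂ) / 2) * (z + 1) ^ ((1 : ℂ) / 2)) := by
  have hne : ∀ x : ℝ, x ∈ Set.Icc (-1 : ℝ) 1 → z - x ≠ 0 := by
    intro x hx h
    exact hz ⟨x, hx, (sub_eq_zero.1 h).symm⟩
  have hz1 : z - 1 ≠ 0 := by simpa using hne 1 (by norm_num)
  have hz2 : z + 1 ≠ 0 := by simpa using hne (-1) (by norm_num)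
  obtain ⟨ha, ha0, ha1⟩ := aux_sqrt _ hz1
  obtain ⟨hb, hb0, hb1⟩ := aux_sqrt _ hz2
  generalize (z - 1) ^ ((1 : ℂ) / 2) = a at *
  generalize (z + 1) ^ ((1 : ℂ) / 2) = b at *
  have hw := aux_re z a b hz ha hb ha0 hb0 ha1 hb1
  have hane : a ≠ 0 := by rintro rfl; simp at ha1
  have hbne : b ≠ 0 := by rintro rfl; simp at hb1
  obtain ⟨w, hwdef⟩ : ∃ w, w = a / b := ⟨_, rfl⟩
  rw [← hwdef] at hw
  have hwa : a = w * b := by rw [hwdef]; field_simp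
  have hs1 : ∀ x ∈ Set.Icc (-1 : ℝ) 1,
      (Real.sqrt (1 - x) : ℂ) + (I * w) * Real.sqrt (1 + x) ∈ Complex.slitPlane := by
    intro x hx
    rcases hx.1.lt_or_eq with h | h
    · right
      have : 0 < Real.sqrt (1 + x) := Real.sqrt_pos.2 (by linarith)
      simp
      exact ⟨hw.ne', this.ne'⟩
    · left
      rw [← h]; simp
  have hs2 : ∀ x ∈ Set.Icc (-1 : ℝ) 1,
      (Real.sqrt (1 - x) : ℂ) + (-(I * w)) * Real.sqrt (1 + x) ∈ Complex.slitPlane := by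
    intro x hx
    rcases hx.1.lt_or_eq with h | h
    · right
      have : 0 < Real.sqrt (1 + x) := Real.sqrt_pos.2 (by linarith)
      simp
      exact ⟨hw.ne', this.ne'⟩
    · left
      rw [← h]; simp
  have key := intervalIntegral.integral_eq_sub_of_hasDerivAt_of_le (a := -1) (b := 1)
    (f := fun x : ℝ => (1 / (I * a * b)) *
      (Complex.log ((Real.sqrt (1 - x) : ℂ) + (I * w) * Real.sqrt (1 + x)) -
       Complex.log ((Real.sqrt (1 - x) : ℂ) + (-(I * w)) * Real.sqrt (1 + x))))
    (f' := fun lam : ℝ => ((Real.sqrt (1 - lam ^ 2) : ℂ) * (z - (lam : ℂ)))⁻¹)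
    (by norm_num) ?_ ?_ ?_
  · rw [key]
    have hlog : Complex.log (I * w * (Real.sqrt 2 : ℝ)) - Complex.log (-(I * w * (Real.sqrt 2 : ℝ)))
        = I * Real.pi := by
      have hs : 0 < Real.sqrt 2 := by positivity
      have : 0 < (I * w * (Real.sqrt 2 : ℝ)).im := by
        simp; exact hw
      apply Complex.ext
      · simp [Complex.log_re]
      · simp only [Complex.sub_im, Complex.log_im]
        rw [Complex.arg_neg_eq_arg_sub_pi_of_im_pos this]
        simp
    have e2 : (1 : ℝ) + 1 = 2 := by norm_num
    have e3 : (1 : ℝ) - (-1) = 2 := by norm_num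
    have e4 : (1 : ℝ) + (-1) = 0 := by norm_num
    simp only [e2, e3, e4, sub_self, Real.sqrt_zero, Complex.ofReal_zero, zero_add, mul_zero,
      add_zero, neg_mul, sub_zero]
    rw [hlog]
    field_simp
  · apply ContinuousOn.mul continuousOn_const
    apply ContinuousOn.sub
    · exact ContinuousOn.clog (by fun_prop) hs1
    · exact ContinuousOn.clog (by fun_prop) hs2
  · intro x hx
    have hx' := Set.Ioo_subset_Icc_self hx
    have d := ((aux_deriv _ x hx (hs1 x hx')).sub (aux_deriv _ x hx (hs2 x hx'))).const_mul
      (1 / (I * a * b))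
    refine HasDerivAt.congr_deriv d ?_
    symm
    have n1 := Complex.slitPlane_ne_zero (hs1 x hx')
    have n2 := Complex.slitPlane_ne_zero (hs2 x hx')
    have hsq : Real.sqrt (1 - x ^ 2) = Real.sqrt (1 - x) * Real.sqrt (1 + x) := by
      rw [← Real.sqrt_mul (by linarith [hx.2])]; ring_nf
    have c2 : (Real.sqrt (1 - x) : ℂ) ^ 2 = 1 - x := by
      exact_mod_cast Real.sq_sqrt (by linarith [hx.2] : 0 ≤ 1 - x)
    have s2 : (Real.sqrt (1 + x) : ℂ) ^ 2 = 1 + x := by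
      exact_mod_cast Real.sq_sqrt (by linarith [hx.1] : 0 ≤ 1 + x)
    have c0 : (Real.sqrt (1 - x) : ℂ) ≠ 0 := by
      exact_mod_cast (Real.sqrt_pos.2 (by linarith [hx.2] : 0 < 1 - x)).ne'
    have s0 : (Real.sqrt (1 + x) : ℂ) ≠ 0 := by
      exact_mod_cast (Real.sqrt_pos.2 (by linarith [hx.1] : 0 < 1 + x)).ne'
    have hzx := hne x hx'
    rw [hsq]
    push_cast
    generalize (Real.sqrt (1 - x) : ℂ) = c at *
    generalize (Real.sqrt (1 + x) : ℂ) = s at *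
    have hprod : (c + I * w * s) * (c + -(I * w) * s) * b ^ 2 = 2 * (z - x) := by
      have : (c + I * w * s) * (c + -(I * w) * s) * b ^ 2 = c ^ 2 * b ^ 2 + (w * b) ^ 2 * s ^ 2 := by
        linear_combination (-(w ^ 2 * s ^ 2 * b ^ 2)) * Complex.I_sq
      rw [this, ← hwa, c2, s2, ha, hb]; ring
    have hzx2 : z - x = (c + I * w * s) * (c + -(I * w) * s) * b ^ 2 / 2 := by
      rw [hprod]; ring
    have hcs : c ^ 2 + s ^ 2 = 2 := by rw [c2, s2]; ring
    have hw0 : w ≠ 0 := by rintro rfl; simp at hw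
    have hd : (-(1 / (2 * c)) + I * w * (1 / (2 * s))) / (c + I * w * s) -
        (-(1 / (2 * c)) + -(I * w) * (1 / (2 * s))) / (c + -(I * w) * s)
        = (I * w * (c ^ 2 + s ^ 2)) / (c * s * ((c + I * w * s) * (c + -(I * w) * s))) := by
      generalize hA : c + I * w * s = A at *
      generalize hB : c + -(I * w) * s = B at *
      field_simp
      rw [← hA, ← hB]
      ring
    rw [hd, hzx2, hcs, hwa]
    generalize c + I * w * s = A at *
    generalize c + -(I * w) * s = B at *
    have := Complex.I_ne_zero
    field_simp
  · have h1 : IntervalIntegrable (fun x : ℝ => (((Real.sqrt (1 - x ^ 2))⁻¹ : ℝ) : ℂ))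
        MeasureTheory.volume (-1) 1 := by
      exact ⟨aux_int.1.ofReal, aux_int.2.ofReal⟩
    have h2 : ContinuousOn (fun x : ℝ => (z - (x : ℂ))⁻¹) (Set.uIcc (-1) 1) := by
      rw [Set.uIcc_of_le (by norm_num)]
      exact ContinuousOn.inv₀ (by fun_prop) hne
    have := h1.mul_continuousOn h2
    convert this using 2 with x
    rw [mul_inv]; push_cast; rfl
end

section
/- For a smooth function f : [-1,1] → ℝ, s(y) = √(1-y²), and x ∈ (-1,1), the Hilbert transform commutes with differentiation: d/dx [ H(1_{(-1,1)} f s) ](x) = [ H( 1_{(-1,1)} (f s)' ) ](x), where (H g)(x) = (1/π) P.V. ∫ g(y)/(x-y) dy. -/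
open Filter

open MeasureTheory Set Topology

/-- the rescaled error kernel -/
noncomputable def psiK (u : ℝ) : ℝ :=
  Real.log (1 - u) - Real.log u + (if 1 < |u| then 1 / u else 0)

lemma psiK_far {u : ℝ} (hu : 2 ≤ |u|) : |psiK u| ≤ 2 / u ^ 2 := by
  have hu0 : u ≠ 0 := by rintro rfl; norm_num at hu
  have hu1 : (1:ℝ) - u ≠ 0 := by
    intro h
    have : u = 1 := by linarith
    rw [this] at hu; norm_num at hu
  have hpos : 0 < |u| := by linarith
  have hx : |1 / u| ≤ 1 / 2 := by
    rw [abs_div, abs_one]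
    exact one_div_le_one_div_of_le (by norm_num) hu
  have h := Real.abs_log_sub_add_sum_range_le (x := 1 / u) (by linarith) 1
  have e : psiK u = 1 / u + Real.log (1 - 1 / u) := by
    unfold psiK
    rw [if_pos (by linarith), ← Real.log_div hu1 hu0, ← Real.log_neg_eq_log]
    have : -((1 - u) / u) = 1 - 1 / u := by field_simp; ring
    rw [this]; ring
  rw [e]
  simp only [Finset.range_one, Finset.sum_singleton, zero_add, pow_one, Nat.cast_zero, div_one] at h
  refine h.trans ?_
  have : |1 / u| ^ (1 + 1) = 1 / u ^ 2 := by rw [sq_abs]; ring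
  rw [this, div_le_iff₀ (by linarith)]
  have : 0 < 1 / u ^ 2 := by positivity
  have e2 : 2 / u ^ 2 = 2 * (1 / u ^ 2) := by ring
  rw [e2]
  nlinarith

lemma psiK_meas : Measurable psiK := by
  unfold psiK
  refine Measurable.add (by fun_prop) (Measurable.ite ?_ (by fun_prop) measurable_const)
  exact measurableSet_lt measurable_const (by fun_prop)

lemma psiK_integrable : Integrable psiK := by
  have h1 : IntervalIntegrable (fun u : ℝ => Real.log (1 - u)) volume (-2) 2 := by
    have := (intervalIntegral.intervalIntegrable_log' (a := 3) (b := -1)).comp_sub_left 1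
    norm_num at this
    exact this
  have h2 : IntervalIntegrable Real.log volume (-2) 2 := intervalIntegral.intervalIntegrable_log'
  have h3 : IntervalIntegrable (fun _ : ℝ => (1:ℝ)) volume (-2) 2 := intervalIntegrable_const
  have h4 := (h1.abs.add h2.abs).add h3
  rw [intervalIntegrable_iff_integrableOn_Ioc_of_le (by norm_num)] at h4
  have h5 := (h4.integrable_indicator measurableSet_Ioc).add (integrable_inv_one_add_sq.const_mul 8)
  refine h5.mono' psiK_meas.aestronglyMeasurable (ae_of_all _ fun u => ?_)
  rw [Real.norm_eq_abs]
  by_cases hu : u ∈ Ioc (-2:ℝ) 2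
  · simp only [Pi.add_apply, indicator_of_mem hu]
    have : |psiK u| ≤ |Real.log (1 - u)| + |Real.log u| + 1 := by
      unfold psiK
      refine (abs_add_le _ _).trans (add_le_add (abs_sub _ _) ?_)
      split_ifs with h
      · rw [abs_div, abs_one, div_le_one (by linarith)]; exact h.le
      · simp
    have : 0 ≤ 8 * (1 + u ^ 2)⁻¹ := by positivity
    linarith
  · simp only [Pi.add_apply, indicator_of_notMem hu]
    have h2 : 2 ≤ |u| := by
      by_contra! h
      rw [abs_lt] at h
      exact hu ⟨h.1, h.2.le⟩
    refine (psiK_far h2).trans ?_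
    have : 4 ≤ u ^ 2 := by rw [← sq_abs]; nlinarith
    rw [zero_add, ← div_eq_mul_inv, div_le_div_iff₀ (by linarith) (by linarith)]
    linarith

lemma log_ker_int {k : ℝ → ℝ} (hk : IntervalIntegrable k volume (-1) 1)
    (hc : ContinuousOn k (Ioo (-1) 1)) {x : ℝ} (hx : x ∈ Ioo (-1:ℝ) 1) :
    IntervalIntegrable (fun y => k y * Real.log (x - y)) volume (-1) 1 := by
  obtain ⟨a, ha1, ha2⟩ := exists_between hx.1
  obtain ⟨b, hb1, hb2⟩ := exists_between hx.2
  have hl : IntervalIntegrable (fun y => Real.log (x - y)) volume a b := by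
    have := (intervalIntegral.intervalIntegrable_log' (a := x - a) (b := x - b)).comp_sub_left x
    simpa using this
  have i1 : IntervalIntegrable (fun y => k y * Real.log (x - y)) volume (-1) a := by
    refine (hk.mono_set ?_).mul_continuousOn ?_
    · rw [uIcc_of_le (by linarith), uIcc_of_le (by linarith)]
      exact Icc_subset_Icc_right (by linarith)
    · rw [uIcc_of_le (by linarith)]
      exact ContinuousOn.log (by fun_prop) (fun y hy => by have := hy.2; linarith)
  have i3 : IntervalIntegrable (fun y => k y * Real.log (x - y)) volume b 1 := by
    refine (hk.mono_set ?_).mul_continuousOn ?_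
    · rw [uIcc_of_le (by linarith), uIcc_of_le (by linarith)]
      exact Icc_subset_Icc_left (by linarith)
    · rw [uIcc_of_le (by linarith)]
      exact ContinuousOn.log (by fun_prop) (fun y hy => by have := hy.1; linarith)
  have i2 : IntervalIntegrable (fun y => k y * Real.log (x - y)) volume a b := by
    refine hl.continuousOn_mul (hc.mono ?_)
    rw [uIcc_of_le (by linarith)]
    exact fun y hy => ⟨by linarith [hy.1], by linarith [hy.2]⟩
  exact (i1.trans i2).trans i3

/-- truncated kernel -/
noncomputable def truK (x ε y : ℝ) : ℝ :=
  if y ≤ x - ε ∨ x + ε < y then 1 / (x - y) else 0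

lemma tru_eq {k : ℝ → ℝ} (hk : IntervalIntegrable k volume (-1) 1) {x ε : ℝ}
    (hε : 0 < ε) (h1 : -1 < x - ε) (h2 : x + ε < 1) :
    IntervalIntegrable (fun y => k y * truK x ε y) volume (-1) 1 ∧
    (∫ y in (-1)..(x - ε), k y / (x - y)) + (∫ y in (x + ε)..1, k y / (x - y))
      = ∫ y in (-1)..1, k y * truK x ε y := by
  have e1 : EqOn (fun y => k y / (x - y)) (fun y => k y * truK x ε y) (uIoc (-1) (x - ε)) := by
    intro y hy
    rw [uIoc_of_le h1.le] at hy
    simp only [truK]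
    rw [if_pos (Or.inl hy.2)]; ring
  have e3 : EqOn (fun y => k y / (x - y)) (fun y => k y * truK x ε y) (uIoc (x + ε) 1) := by
    intro y hy
    rw [uIoc_of_le h2.le] at hy
    simp only [truK]
    rw [if_pos (Or.inr hy.1)]; ring
  have e2 : EqOn (fun y => 0) (fun y => k y * truK x ε y) (uIoc (x - ε) (x + ε)) := by
    intro y hy
    rw [uIoc_of_le (by linarith)] at hy
    simp only [truK]
    rw [if_neg (by rintro (h | h); exacts [absurd h (not_le.2 hy.1), absurd h (not_lt.2 hy.2)])]
    ring
  have j1 : IntervalIntegrable (fun y => k y / (x - y)) volume (-1) (x - ε) := by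
    simp only [div_eq_mul_inv]
    refine (hk.mono_set ?_).mul_continuousOn ?_
    · rw [uIcc_of_le (by linarith), uIcc_of_le (by linarith)]
      exact Icc_subset_Icc_right (by linarith)
    · rw [uIcc_of_le (by linarith)]
      exact ContinuousOn.inv₀ (by fun_prop) (fun y hy => by have := hy.2; linarith)
  have j3 : IntervalIntegrable (fun y => k y / (x - y)) volume (x + ε) 1 := by
    simp only [div_eq_mul_inv]
    refine (hk.mono_set ?_).mul_continuousOn ?_
    · rw [uIcc_of_le (by linarith), uIcc_of_le (by linarith)]
      exact Icc_subset_Icc_left (by linarith)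
    · rw [uIcc_of_le (by linarith)]
      exact ContinuousOn.inv₀ (by fun_prop) (fun y hy => by have := hy.1; linarith)
  have i1 := j1.congr e1
  have i3 := j3.congr e3
  have i2 := (IntervalIntegrable.zero (μ := volume) (a := x - ε) (b := x + ε) (E := ℝ)).congr e2
  refine ⟨(i1.trans i2).trans i3, ?_⟩
  rw [← intervalIntegral.integral_add_adjacent_intervals (i1.trans i2) i3,
    ← intervalIntegral.integral_add_adjacent_intervals i1 i2,
    intervalIntegral.integral_congr_ae (ae_of_all _ fun y hy => e1 hy),
    intervalIntegral.integral_congr_ae (ae_of_all _ fun y hy => e3 hy),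
    ← intervalIntegral.integral_congr_ae (ae_of_all _ fun y hy => e2 hy)]
  simp

/-- difference of the difference quotient and the truncated integral -/
noncomputable def errT (k : ℝ → ℝ) (x h : ℝ) : ℝ :=
  h⁻¹ * ((∫ y in (-1)..1, k y * Real.log (x + h - y)) - ∫ y in (-1)..1, k y * Real.log (x - y))
    - ((∫ y in (-1)..(x - |h|), k y / (x - y)) + (∫ y in (x + |h|)..1, k y / (x - y)))

lemma ev_small {x : ℝ} (hx : x ∈ Ioo (-1:ℝ) 1) :
    ∀ᶠ h in 𝓝[≠] (0:ℝ), h ≠ 0 ∧ -1 < x - |h| ∧ x + |h| < 1 ∧ x + h ∈ Ioo (-1:ℝ) 1 := by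
  have hδ : 0 < min (x + 1) (1 - x) := lt_min (by linarith [hx.1]) (by linarith [hx.2])
  have h1 : ∀ᶠ h in 𝓝[≠] (0:ℝ), |h| < min (x + 1) (1 - x) := by
    have : Tendsto (fun h : ℝ => |h|) (𝓝[≠] 0) (𝓝 0) := by
      have := (continuous_abs (G := ℝ)).tendsto 0
      rw [abs_zero] at this
      exact this.mono_left nhdsWithin_le_nhds
    exact this.eventually_lt_const hδ
  filter_upwards [h1, self_mem_nhdsWithin] with h hh h0
  have ⟨a, b⟩ := lt_min_iff.1 hh
  have := neg_abs_le h
  have := le_abs_self h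
  exact ⟨h0, by linarith, by linarith, by linarith, by linarith⟩

lemma errT_eq {k : ℝ → ℝ} (hk : IntervalIntegrable k volume (-1) 1)
    (hc : ContinuousOn k (Ioo (-1) 1)) {x h : ℝ} (hx : x ∈ Ioo (-1:ℝ) 1)
    (h0 : h ≠ 0) (h1 : -1 < x - |h|) (h2 : x + |h| < 1) (h3 : x + h ∈ Ioo (-1:ℝ) 1) :
    errT k x h = ∫ y in (-1)..1, k y *
      (h⁻¹ * (Real.log (x + h - y) - Real.log (x - y)) - truK x |h| y) := by
  obtain ⟨t1, t2⟩ := tru_eq hk (abs_pos.2 h0) h1 h2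
  have l1 := log_ker_int hk hc hx
  have l2 := log_ker_int hk hc h3
  unfold errT
  rw [t2, ← intervalIntegral.integral_sub l2 l1, ← intervalIntegral.integral_const_mul,
    ← intervalIntegral.integral_sub ((l2.sub l1).const_mul _) t1]
  congr 1
  ext y
  ring

lemma ker_eq {x h y : ℝ} (h0 : h ≠ 0) (hy : y ∉ ({x, x + h, x - h} : Set ℝ)) :
    h⁻¹ * (Real.log (x + h - y) - Real.log (x - y)) - truK x |h| y
      = h⁻¹ * psiK ((y - x) / h) := by
  simp only [mem_insert_iff, mem_singleton_iff, not_or] at hy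
  obtain ⟨a, b, c⟩ := hy
  have hyx : y - x ≠ 0 := sub_ne_zero.2 a
  have e1 : Real.log (x + h - y) = Real.log h + Real.log (1 - (y - x) / h) := by
    rw [← Real.log_mul h0]
    · congr 1; field_simp; ring
    · intro h'
      field_simp at h'
      apply b; linarith
  have e2 : Real.log (x - y) = Real.log h + Real.log ((y - x) / h) := by
    rw [← Real.log_mul h0 (div_ne_zero hyx h0), ← Real.log_neg_eq_log]
    congr 1; field_simp; ring
  have e3 : truK x |h| y = - (h⁻¹ * (if 1 < |(y - x) / h| then 1 / ((y - x) / h) else 0)) := by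
    unfold truK
    have hne : |h| ≠ |y - x| := by
      intro h'
      rcases abs_eq_abs.1 h' with h' | h'
      · apply b; linarith
      · apply c; linarith
    have hiff : (y ≤ x - |h| ∨ x + |h| < y) ↔ 1 < |(y - x) / h| := by
      rw [abs_div, one_lt_div (abs_pos.2 h0)]
      constructor
      · rintro (h' | h')
        · refine lt_of_le_of_ne ?_ hne
          have := neg_abs_le (y - x); linarith
        · have := le_abs_self (y - x); linarith
      · intro h'
        rcases lt_abs.1 h' with h' | h'
        · right; linarith
        · left; linarith
    have hxy : x - y ≠ 0 := sub_ne_zero.2 (Ne.symm a)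
    by_cases hh : 1 < |(y - x) / h|
    · rw [if_pos (hiff.2 hh), if_pos hh, ← neg_sub y x]
      field_simp
    · rw [if_neg (mt hiff.1 hh), if_neg hh]; ring
  rw [e1, e2, e3, psiK]
  ring

lemma errT_zero {k : ℝ → ℝ} (hk : IntervalIntegrable k volume (-1) 1)
    (hc : ContinuousOn k (Ioo (-1) 1)) {x : ℝ} (hx : x ∈ Ioo (-1:ℝ) 1) (hkx : k x = 0) :
    Tendsto (errT k x) (𝓝[≠] 0) (𝓝 0) := by
  set I := ∫ u, |psiK u| with hI
  have hI0 : 0 ≤ I := integral_nonneg fun _ => abs_nonneg _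
  set J := ∫ y in (-1)..1, |k y| with hJ
  rw [Metric.tendsto_nhds]
  intro e he
  set η := e / (2 * (I + 1)) with hη
  have hηpos : 0 < η := by positivity
  have hcx : ContinuousAt k x := hc.continuousAt (Ioo_mem_nhds hx.1 hx.2)
  obtain ⟨δ, hδ, hball⟩ := Metric.continuousAt_iff.1 hcx η hηpos
  have habs : Tendsto (fun h : ℝ => |h|) (𝓝[≠] 0) (𝓝 0) := by
    have := (continuous_abs (G := ℝ)).tendsto 0
    rw [abs_zero] at this
    exact this.mono_left nhdsWithin_le_nhds
  have hs1 : ∀ᶠ h in 𝓝[≠] (0:ℝ), |h| < δ / 2 := habs.eventually_lt_const (by positivity)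
  have hs2 : ∀ᶠ h in 𝓝[≠] (0:ℝ), 2 * |h| / δ ^ 2 * J < e / 2 := by
    have : Tendsto (fun h : ℝ => 2 * |h| / δ ^ 2 * J) (𝓝[≠] 0) (𝓝 (2 * 0 / δ ^ 2 * J)) :=
      ((habs.const_mul 2).div_const _).mul_const _
    refine this.eventually_lt_const ?_
    simp; positivity
  filter_upwards [ev_small hx, hs1, hs2] with h ⟨h0, h1, h2, h3⟩ hh1 hh2
  have hh0 := abs_pos.2 h0
  rw [Real.dist_eq, sub_zero, errT_eq hk hc hx h0 h1 h2 h3]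
  have hpsi : Integrable (fun y => |psiK ((y - x) / h)|) :=
    ((psiK_integrable.abs.comp_div h0).comp_sub_right x)
  have hpI : ∫ y, |psiK ((y - x) / h)| = |h| * I := by
    rw [integral_sub_right_eq_self (fun y => |psiK (y / h)|) x,
      Measure.integral_comp_div (fun y => |psiK y|) h]
    simp [hI]
  have hbound : ‖∫ y in (-1)..1, k y *
      (h⁻¹ * (Real.log (x + h - y) - Real.log (x - y)) - truK x |h| y)‖ ≤
      ∫ y in (-1)..1, (η * |h|⁻¹ * |psiK ((y - x) / h)| + 2 * |h| / δ ^ 2 * |k y|) := by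
    refine intervalIntegral.norm_integral_le_of_norm_le (by norm_num) ?_
      ((hpsi.intervalIntegrable.const_mul _).add (hk.abs.const_mul _))
    have hfin : ({x, x + h, x - h} : Set ℝ).Finite := by simp
    have := hfin.countable.ae_notMem (volume : Measure ℝ)
    filter_upwards [this] with y hy _
    rw [ker_eq h0 hy, norm_mul, norm_mul, norm_inv]
    simp only [Real.norm_eq_abs]
    by_cases hyd : |y - x| < δ
    · have := hball (by rwa [Real.dist_eq])
      rw [hkx, Real.dist_eq, sub_zero] at this
      have p1 : 0 ≤ 2 * |h| / δ ^ 2 * |k y| := by positivity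
      have p2 : 0 ≤ |h|⁻¹ * |psiK ((y - x) / h)| := by positivity
      nlinarith [mul_le_mul_of_nonneg_right this.le p2]
    · push Not at hyd
      have hu : 2 ≤ |(y - x) / h| := by
        rw [abs_div, le_div_iff₀ hh0]; linarith
      have hf := psiK_far hu
      have p1 : 0 ≤ η * |h|⁻¹ * |psiK ((y - x) / h)| := by positivity
      have p3 : |h|⁻¹ * |psiK ((y - x) / h)| ≤ 2 * |h| / δ ^ 2 := by
        calc |h|⁻¹ * |psiK ((y - x) / h)| ≤ |h|⁻¹ * (2 / ((y - x) / h) ^ 2) := by gcongr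
          _ = 2 * |h| / |y - x| ^ 2 := by
            rw [div_pow, ← sq_abs (y - x), ← sq_abs h]
            field_simp
          _ ≤ _ := by gcongr
      have := mul_le_mul_of_nonneg_left p3 (abs_nonneg (k y))
      linarith
  rw [← Real.norm_eq_abs]
  refine hbound.trans_lt ?_
  rw [intervalIntegral.integral_add (hpsi.intervalIntegrable.const_mul _) (hk.abs.const_mul _),
    intervalIntegral.integral_const_mul, intervalIntegral.integral_const_mul]
  have hle : ∫ y in (-1)..1, |psiK ((y - x) / h)| ≤ |h| * I := by
    rw [← hpI, intervalIntegral.integral_of_le (by norm_num)]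
    exact setIntegral_le_integral hpsi (ae_of_all _ fun _ => abs_nonneg _)
  have : η * |h|⁻¹ * ∫ y in (-1)..1, |psiK ((y - x) / h)| ≤ η * |h|⁻¹ * (|h| * I) := by gcongr
  have e4 : η * |h|⁻¹ * (|h| * I) = η * I := by field_simp
  have e5 : η * (I + 1) = e / 2 := by rw [hη]; field_simp
  nlinarith

lemma errT_const (c : ℝ) {x : ℝ} (hx : x ∈ Ioo (-1:ℝ) 1) :
    Tendsto (errT (fun _ => c) x) (𝓝[≠] 0) (𝓝 0) := by
  have hL : ∀ z : ℝ, ∫ y in (-1)..1, c * Real.log (z - y) =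
      c * ((z + 1) * Real.log (z + 1) - (z - 1) * Real.log (z - 1) - 2) := by
    intro z
    rw [intervalIntegral.integral_const_mul,
      intervalIntegral.integral_comp_sub_left (fun y => Real.log y) z, integral_log, sub_neg_eq_add]
    ring
  have hd : HasDerivAt (fun z => ∫ y in (-1)..1, c * Real.log (z - y))
      (c * (Real.log (x + 1) - Real.log (x - 1))) x := by
    simp only [hL]
    have a1 := (Real.hasDerivAt_mul_log (x := x + 1) (by linarith [hx.1])).comp_add_const x 1
    have a2 := (Real.hasDerivAt_mul_log (x := x - 1) (by linarith [hx.2])).comp_sub_const x 1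
    refine HasDerivAt.congr_deriv (((a1.sub a2).sub_const 2).const_mul c) ?_
    ring
  rw [hasDerivAt_iff_tendsto_slope_zero] at hd
  have := hd.sub_const (c * (Real.log (x + 1) - Real.log (x - 1)))
  rw [sub_self] at this
  refine this.congr' ?_
  filter_upwards [ev_small hx] with h ⟨h0, h1, h2, h3⟩
  have hh0 := abs_pos.2 h0
  unfold errT
  rw [smul_eq_mul]
  congr 1
  simp only [div_eq_mul_inv]
  rw [intervalIntegral.integral_const_mul, intervalIntegral.integral_const_mul,
    intervalIntegral.integral_comp_sub_left (fun y => y⁻¹) x,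
    intervalIntegral.integral_comp_sub_left (fun y => y⁻¹) x,
    integral_inv_of_pos (by linarith) (by linarith [hx.1]),
    integral_inv_of_neg (by linarith [hx.2]) (by linarith)]
  rw [Real.log_div (by linarith [hx.1]) (by linarith), Real.log_div (by linarith) (by linarith [hx.2])]
  have : Real.log (x - (x + |h|)) = Real.log (x - (x - |h|)) := by
    rw [← Real.log_neg_eq_log]; congr 1; ring
  rw [this]
  ring_nf

lemma errT_tendsto {k : ℝ → ℝ} (hk : IntervalIntegrable k volume (-1) 1)
    (hc : ContinuousOn k (Ioo (-1) 1)) {x : ℝ} (hx : x ∈ Ioo (-1:ℝ) 1) :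
    Tendsto (errT k x) (𝓝[≠] 0) (𝓝 0) := by
  have hk1 : IntervalIntegrable (fun y => k y - k x) volume (-1) 1 :=
    hk.sub intervalIntegrable_const
  have hc1 : ContinuousOn (fun y => k y - k x) (Ioo (-1) 1) := hc.sub continuousOn_const
  have hk2 : IntervalIntegrable (fun _ : ℝ => k x) volume (-1) 1 := intervalIntegrable_const
  have hc2 : ContinuousOn (fun _ : ℝ => k x) (Ioo (-1) 1) := continuousOn_const
  have := (errT_zero hk1 hc1 hx (sub_self _)).add (errT_const (k x) hx)
  rw [add_zero] at this
  refine this.congr' ?_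
  filter_upwards [ev_small hx] with h ⟨h0, h1, h2, h3⟩
  have A : ∀ {k : ℝ → ℝ}, IntervalIntegrable k volume (-1) 1 → ContinuousOn k (Ioo (-1) 1) →
      IntervalIntegrable (fun y => k y *
      (h⁻¹ * (Real.log (x + h - y) - Real.log (x - y)) - truK x |h| y)) volume (-1) 1 := by
    intro k hk hc
    have := (((log_ker_int hk hc h3).sub (log_ker_int hk hc hx)).const_mul h⁻¹).sub
      (tru_eq hk (abs_pos.2 h0) h1 h2).1
    refine this.congr (fun y _ => ?_)
    ring
  rw [errT_eq hk hc hx h0 h1 h2 h3, errT_eq hk1 hc1 hx h0 h1 h2 h3,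
    errT_eq hk2 hc2 hx h0 h1 h2 h3, ← intervalIntegral.integral_add (A hk1 hc1) (A hk2 hc2)]
  congr 1
  ext y
  ring

lemma fs_facts {f : ℝ → ℝ} (hf : ContDiffOn ℝ 1 f (Icc (-1 : ℝ) 1)) :
    ContinuousOn (fun u => f u * Real.sqrt (1 - u ^ 2)) (Icc (-1) 1) ∧
    (∀ y ∈ Ioo (-1:ℝ) 1, HasDerivAt (fun u => f u * Real.sqrt (1 - u ^ 2))
      (deriv (fun u => f u * Real.sqrt (1 - u ^ 2)) y) y) ∧
    ContinuousOn (deriv (fun u => f u * Real.sqrt (1 - u ^ 2))) (Ioo (-1) 1) ∧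
    IntervalIntegrable (deriv (fun u => f u * Real.sqrt (1 - u ^ 2))) volume (-1) 1 := by
  have hs : Continuous (fun u : ℝ => Real.sqrt (1 - u ^ 2)) := by fun_prop
  have hfd : ContinuousOn (derivWithin f (Icc (-1) 1)) (Icc (-1) 1) :=
    hf.continuousOn_derivWithin (uniqueDiffOn_Icc (by norm_num)) le_rfl
  have hd : ∀ y ∈ Ioo (-1:ℝ) 1, HasDerivAt (fun u => f u * Real.sqrt (1 - u ^ 2))
      (derivWithin f (Icc (-1) 1) y * Real.sqrt (1 - y ^ 2)
        + (f y * (-y)) * (Real.sqrt (1 - y ^ 2))⁻¹) y := by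
    intro y hy
    have hpos : 0 < 1 - y ^ 2 := by nlinarith [hy.1, hy.2]
    have a1 : HasDerivAt f (derivWithin f (Icc (-1) 1) y) y :=
      ((hf.differentiableOn one_ne_zero y (Ioo_subset_Icc_self hy)).hasDerivWithinAt).hasDerivAt
        (Icc_mem_nhds hy.1 hy.2)
    have a2 : HasDerivAt (fun u : ℝ => 1 - u ^ 2) (-(2 * y)) y := by
      simpa using (hasDerivAt_pow 2 y).const_sub 1
    have a3 := a1.mul (a2.sqrt hpos.ne')
    refine HasDerivAt.congr_deriv a3 ?_
    have := (Real.sqrt_pos.2 hpos).ne'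
    field_simp
  have heq : EqOn (fun y => derivWithin f (Icc (-1) 1) y * Real.sqrt (1 - y ^ 2)
        + (f y * (-y)) * (Real.sqrt (1 - y ^ 2))⁻¹)
      (deriv (fun u => f u * Real.sqrt (1 - u ^ 2))) (Ioo (-1) 1) :=
    fun y hy => (hd y hy).deriv.symm
  refine ⟨hf.continuousOn.mul hs.continuousOn, fun y hy => ?_, ?_, ?_⟩
  · exact (hd y hy).differentiableAt.hasDerivAt
  · refine ContinuousOn.congr ?_ heq.symm
    have h1 := hfd.mono Ioo_subset_Icc_self
    have h2 := hf.continuousOn.mono Ioo_subset_Icc_self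
    refine (h1.mul hs.continuousOn).add ((h2.mul continuousOn_neg).mul
      (hs.continuousOn.inv₀ fun y hy => ?_))
    exact (Real.sqrt_pos.2 (by nlinarith [hy.1, hy.2])).ne'
  · have i0 : IntervalIntegrable (fun y : ℝ => (Real.sqrt (1 - y ^ 2))⁻¹) volume (-1) 1 := by
      simpa [Real.sqrt_inv] using Polynomial.Chebyshev.intervalIntegrable_sqrt_one_sub_sq_inv
    have i1 : IntervalIntegrable (fun y => derivWithin f (Icc (-1) 1) y * Real.sqrt (1 - y ^ 2)
        + (f y * (-y)) * (Real.sqrt (1 - y ^ 2))⁻¹) volume (-1) 1 := by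
      refine IntervalIntegrable.add (ContinuousOn.intervalIntegrable ?_)
        (i0.continuousOn_mul ?_)
      · rw [uIcc_of_le (by norm_num)]
        exact hfd.mul hs.continuousOn
      · rw [uIcc_of_le (by norm_num)]
        exact hf.continuousOn.mul continuousOn_neg
    rw [intervalIntegrable_iff_integrableOn_Ioo_of_le (by norm_num)] at i1 ⊢
    exact i1.congr_fun heq measurableSet_Ioo

lemma pv_eq {g k : ℝ → ℝ} (hg : ContinuousOn g (Icc (-1) 1)) (g1 : g (-1) = 0) (g2 : g 1 = 0)
    (hd : ∀ y ∈ Ioo (-1:ℝ) 1, HasDerivAt g (k y) y)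
    (hk : IntervalIntegrable k volume (-1) 1) (hc : ContinuousOn k (Ioo (-1) 1))
    {x : ℝ} (hx : x ∈ Ioo (-1:ℝ) 1) :
    Tendsto (fun ε : ℝ => (∫ y in (-1)..(x - ε), g y / (x - y)) + ∫ y in (x + ε)..1, g y / (x - y))
      (𝓝[>] 0) (𝓝 (∫ y in (-1)..1, k y * Real.log (x - y))) := by
  have hl := log_ker_int hk hc hx
  have hev : ∀ᶠ ε in 𝓝[>] (0:ℝ), 0 < ε ∧ -1 < x - ε ∧ x + ε < 1 := by
    filter_upwards [Ioo_mem_nhdsGT (show (0:ℝ) < min (x + 1) (1 - x) from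
      lt_min (by linarith [hx.1]) (by linarith [hx.2]))] with ε hε
    have ⟨a, b⟩ := lt_min_iff.1 hε.2
    exact ⟨hε.1, by linarith, by linarith⟩
  have hm : Tendsto (fun ε : ℝ => x - ε) (𝓝[>] 0) (𝓝 x) := by
    have : Tendsto (fun ε : ℝ => x - ε) (𝓝 0) (𝓝 (x - 0)) := (by fun_prop : Continuous _).tendsto 0
    rw [sub_zero] at this
    exact this.mono_left nhdsWithin_le_nhds
  have hp : Tendsto (fun ε : ℝ => x + ε) (𝓝[>] 0) (𝓝 x) := by
    have : Tendsto (fun ε : ℝ => x + ε) (𝓝 0) (𝓝 (x + 0)) := (by fun_prop : Continuous _).tendsto 0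
    rw [add_zero] at this
    exact this.mono_left nhdsWithin_le_nhds
  have hprim : ContinuousAt (fun b => ∫ y in (-1)..b, k y * Real.log (x - y)) x := by
    have := intervalIntegral.continuousOn_primitive_interval' hl left_mem_uIcc
    rw [uIcc_of_le (by norm_num)] at this
    exact this.continuousAt (Icc_mem_nhds hx.1 hx.2)
  have t1 := hprim.tendsto.comp hm
  have t2 := (hprim.tendsto.comp hp).const_sub (∫ y in (-1)..1, k y * Real.log (x - y))
  -- boundary term
  have hgO : (fun ε : ℝ => g (x + ε) - g (x - ε)) =O[𝓝[>] 0] (fun ε => ε) := by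
    have o := (hd x hx).isBigO_sub
    have o1 := (o.comp_tendsto hp)
    have o2 := (o.comp_tendsto hm)
    simp only [Function.comp_def] at o1 o2
    have o1' : (fun ε : ℝ => g (x + ε) - g x) =O[𝓝[>] 0] (fun ε : ℝ => ε) := by simpa using o1
    have o2' : (fun ε : ℝ => g (x - ε) - g x) =O[𝓝[>] 0] (fun ε : ℝ => ε) := by
      have := o2.neg_right
      simpa using this
    simpa using o1'.sub o2'
  have t3 : Tendsto (fun ε : ℝ => (g (x + ε) - g (x - ε)) * Real.log ε) (𝓝[>] 0) (𝓝 0) := by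
    have o := hgO.mul (Asymptotics.isBigO_refl Real.log (𝓝[>] 0))
    refine o.trans_tendsto ?_
    have := Real.continuous_mul_log.tendsto 0
    simp only [zero_mul] at this
    exact this.mono_left nhdsWithin_le_nhds
  have t := t3.add (t1.add t2)
  have : (0:ℝ) + ((∫ y in (-1)..x, k y * Real.log (x - y)) +
      ((∫ y in (-1)..1, k y * Real.log (x - y)) - ∫ y in (-1)..x, k y * Real.log (x - y)))
      = ∫ y in (-1)..1, k y * Real.log (x - y) := by ring
  rw [this] at t
  refine t.congr' ?_
  filter_upwards [hev] with ε ⟨h0, h1, h2⟩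
  simp only [Function.comp_def]
  have ibp : ∀ a b : ℝ, a ≤ b → -1 ≤ a → b ≤ 1 → x ∉ Icc a b →
      ∫ y in a..b, g y / (x - y) = g b * (-Real.log (x - b)) - g a * (-Real.log (x - a))
        + ∫ y in a..b, k y * Real.log (x - y) := by
    intro a b hab ha hb hxab
    have hne : ∀ y ∈ Icc a b, x - y ≠ 0 := fun y hy h => hxab (by
      have : x = y := by linarith
      rwa [this])
    have := intervalIntegral.integral_mul_deriv_eq_deriv_mul_of_hasDerivAt (a := a) (b := b)
      (u := g) (u' := k) (v := fun y => -Real.log (x - y)) (v' := fun y => (x - y)⁻¹)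
      (by rw [uIcc_of_le hab]; exact hg.mono (Icc_subset_Icc ha hb))
      (by rw [uIcc_of_le hab]; exact (ContinuousOn.log (by fun_prop) hne).neg)
      (by rw [min_eq_left hab, max_eq_right hab]
          exact fun y hy => hd y ⟨by linarith [hy.1], by linarith [hy.2]⟩)
      (by rw [min_eq_left hab, max_eq_right hab]
          intro y hy
          have := (((hasDerivAt_id y).const_sub x).log (hne y (Ioo_subset_Icc_self hy))).neg
          refine HasDerivAt.congr_deriv this ?_
          simp [div_eq_mul_inv])
      (hk.mono_set (by
        rw [uIcc_of_le hab, uIcc_of_le (by norm_num)]; exact Icc_subset_Icc ha hb))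
      (ContinuousOn.intervalIntegrable (by
        rw [uIcc_of_le hab]; exact ContinuousOn.inv₀ (by fun_prop) hne))
    simp only [div_eq_mul_inv]
    rw [this]
    simp only [mul_neg, intervalIntegral.integral_neg]
    ring
  rw [ibp (-1) (x - ε) h1.le le_rfl (by linarith) (fun h => by linarith [h.2]),
    ibp (x + ε) 1 h2.le (by linarith) le_rfl (fun h => by linarith [h.1]), g1, g2]
  have hsplit := intervalIntegral.integral_interval_sub_left hl
    (hl.mono_set (c := -1) (d := x + ε) (by
      rw [uIcc_of_le (by linarith), uIcc_of_le (by norm_num)]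
      exact Icc_subset_Icc le_rfl h2.le))
  rw [hsplit]
  have q1 : x - (x - ε) = ε := by ring
  have q2 : Real.log (x - (x + ε)) = Real.log ε := by
    rw [← Real.log_neg_eq_log]; congr 1; ring
  rw [q1, q2]
  ring

/-- For `f` of class `C¹` on `[-1,1]` and `s(y) = √(1-y²)`, the Hilbert
transform commutes with differentiation:
`d/dx [H(1_{(-1,1)} f s)](x) = [H(1_{(-1,1)} (f s)')](x)` for `x ∈ (-1,1)`.
`F` is the Hilbert transform of `1_{(-1,1)} f s` and `G` the Hilbert transform
of `1_{(-1,1)} (f s)'` at `x₀`, both formalized as principal-value limits. -/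
theorem hilbert_transform_deriv_comm (f : ℝ → ℝ)
    (hf : ContDiffOn ℝ 1 f (Set.Icc (-1 : ℝ) 1))
    (F : ℝ → ℝ)
    (hF : ∀ x ∈ Set.Ioo (-1 : ℝ) 1, Tendsto (fun ε : ℝ =>
        (1 / Real.pi) *
          ((∫ y in (-1 : ℝ)..(x - ε), f y * Real.sqrt (1 - y ^ 2) / (x - y)) +
            ∫ y in (x + ε)..(1 : ℝ), f y * Real.sqrt (1 - y ^ 2) / (x - y)))
      (nhdsWithin 0 (Set.Ioi 0)) (nhds (F x)))
    (x₀ : ℝ) (hx₀ : x₀ ∈ Set.Ioo (-1 : ℝ) 1) (G : ℝ)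
    (hG : Tendsto (fun ε : ℝ =>
        (1 / Real.pi) *
          ((∫ y in (-1 : ℝ)..(x₀ - ε),
              deriv (fun u => f u * Real.sqrt (1 - u ^ 2)) y / (x₀ - y)) +
            ∫ y in (x₀ + ε)..(1 : ℝ),
              deriv (fun u => f u * Real.sqrt (1 - u ^ 2)) y / (x₀ - y)))
      (nhdsWithin 0 (Set.Ioi 0)) (nhds G)) :
    HasDerivAt F G x₀ := by
  obtain ⟨hg, hd, hc, hk⟩ := fs_facts hf
  set g : ℝ → ℝ := fun u => f u * Real.sqrt (1 - u ^ 2) with hgdef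
  have hFx : ∀ x ∈ Ioo (-1:ℝ) 1,
      F x = (1 / Real.pi) * ∫ y in (-1)..1, deriv g y * Real.log (x - y) := by
    intro x hx
    exact tendsto_nhds_unique (hF x hx)
      ((pv_eq hg (by simp [hgdef]) (by simp [hgdef]) hd hk hc hx).const_mul _)
  have habs : Tendsto (fun h : ℝ => |h|) (𝓝[≠] 0) (𝓝[>] 0) := by
    refine tendsto_nhdsWithin_iff.2 ⟨?_, ?_⟩
    · have := (continuous_abs (G := ℝ)).tendsto 0
      rw [abs_zero] at this
      exact this.mono_left nhdsWithin_le_nhds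
    · filter_upwards [self_mem_nhdsWithin] with h h0
      exact abs_pos.2 h0
  rw [hasDerivAt_iff_tendsto_slope_zero]
  have t := ((errT_tendsto hk hc hx₀).const_mul (1 / Real.pi)).add (hG.comp habs)
  rw [mul_zero, zero_add] at t
  refine t.congr' ?_
  filter_upwards [ev_small hx₀] with h ⟨_, _, _, h3⟩
  rw [hFx _ h3, hFx _ hx₀]
  simp only [Function.comp_def, errT, smul_eq_mul]
  ring
end

section
/- Let V be a one-cut regular potential with equilibrium measure μ_V(dx) = d(x)√(1-x²)dx supported on [-1,1], where d is real analytic and positive on [-1,1] and the Euler–Lagrange equality 2∫ log|x−y| μ_V(dy) = V(x) + ℓ_V holds on [-1,1]. Then for every x ∈ (-1,1), P.V. ∫_{-1}^{1} V'(λ) √(1-λ²)/(λ − x) dλ = −2π + 2π² d(x)(1 − x²). -/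
open Filter

namespace EqPV
open MeasureTheory Polynomial Polynomial.Chebyshev

noncomputable def cc (f : ℝ → ℝ) : ℝ := ∫ x, f x * (1 - x ^ 2) ∂measureT

noncomputable def TT (f : ℝ → ℝ) (y : ℝ) : ℝ :=
  (∫ x, dslope f y x * (1 - x ^ 2) ∂measureT) - Real.pi * y * f y

lemma mul_sqrt_inv (a : ℝ) : a * √(a⁻¹) = √a := by
  rcases le_or_gt 0 a with h | h
  · rw [Real.sqrt_inv, ← div_eq_mul_inv, Real.div_sqrt]
  · rw [Real.sqrt_eq_zero_of_nonpos (inv_nonpos.2 h.le), Real.sqrt_eq_zero_of_nonpos h.le, mul_zero]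

lemma int_sqrt (f : ℝ → ℝ) :
    ∫ x in (-1 : ℝ)..1, f x * √(1 - x ^ 2) = ∫ x, f x * (1 - x ^ 2) ∂measureT := by
  rw [integral_measureT]
  congr 1
  ext x
  rw [mul_assoc, mul_sqrt_inv]

lemma measureT_ac : measureT ≪ (volume : Measure ℝ) := by
  unfold measureT
  exact Measure.absolutelyContinuous_of_le Measure.restrict_le_self |>.trans
    (withDensity_absolutelyContinuous _ _)

lemma ae_ne (y : ℝ) : ∀ᵐ x ∂measureT, x ≠ y := by
  apply measureT_ac.ae_le
  exact Measure.ae_ne volume y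

lemma ae_mem : ∀ᵐ x ∂measureT, x ∈ Set.Ioo (-1 : ℝ) 1 := by
  have h1 : ∀ᵐ x ∂measureT, x ∈ Set.Ioc (-1 : ℝ) 1 := by
    unfold measureT
    exact ae_restrict_mem measurableSet_Ioc
  filter_upwards [h1, ae_ne 1] with x hx h
  exact ⟨hx.1, lt_of_le_of_ne hx.2 h⟩

instance : IsFiniteMeasure measureT := by
  have := integrable_measureT (f := fun _ => 1) continuousOn_const
  rw [integrable_const_iff] at this
  simpa using this

lemma mass : ∫ _x : ℝ, (1:ℝ) ∂measureT = Real.pi := by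
  simpa using integral_eval_T_real_measureT_zero

lemma integ {f : ℝ → ℝ} (hf : Continuous f) : Integrable f measureT :=
  integrable_measureT hf.continuousOn

lemma cont_dslope {f : ℝ → ℝ} (hf : Continuous f) {y : ℝ} (hy : DifferentiableAt ℝ f y) :
    Continuous (dslope f y) := by
  rw [continuous_iff_continuousAt]
  intro x
  rcases eq_or_ne x y with rfl | h
  · exact continuousAt_dslope_same.2 hy
  · exact (continuousAt_dslope_of_ne h).2 hf.continuousAt

lemma integ_ds {f : ℝ → ℝ} (hf : Differentiable ℝ f) (y : ℝ) :
    Integrable (fun x => dslope f y x * (1 - x ^ 2)) measureT :=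
  integ ((cont_dslope hf.continuous (hf y)).mul (by fun_prop))

lemma ds_ne {f : ℝ → ℝ} {y x : ℝ} (h : x ≠ y) : dslope f y x = (f x - f y) / (x - y) := by
  rw [dslope_of_ne _ h, slope_def_field]

lemma TT_add {f g : ℝ → ℝ} (hf : Differentiable ℝ f) (hg : Differentiable ℝ g) (y : ℝ) :
    TT (fun x => f x + g x) y = TT f y + TT g y := by
  have : ∫ x, dslope (fun x => f x + g x) y x * (1 - x ^ 2) ∂measureT =
      ∫ x, (dslope f y x * (1 - x ^ 2) + dslope g y x * (1 - x ^ 2)) ∂measureT := by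
    apply integral_congr_ae
    filter_upwards [ae_ne y] with x hx
    simp only [ds_ne hx]; ring
  unfold TT
  rw [this, integral_add (integ_ds hf y) (integ_ds hg y)]
  ring

lemma TT_smul (a : ℝ) (f : ℝ → ℝ) (y : ℝ) :
    TT (fun x => a * f x) y = a * TT f y := by
  have : ∫ x, dslope (fun x => a * f x) y x * (1 - x ^ 2) ∂measureT =
      ∫ x, a * (dslope f y x * (1 - x ^ 2)) ∂measureT := by
    apply integral_congr_ae
    filter_upwards [ae_ne y] with x hx
    simp only [ds_ne hx]; ring
  unfold TT
  rw [this, integral_const_mul]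
  ring

lemma TT_one (y : ℝ) : TT (fun _ => 1) y = - Real.pi * y := by
  have : ∫ x, dslope (fun _ => (1:ℝ)) y x * (1 - x ^ 2) ∂measureT = ∫ x, 0 ∂measureT := by
    apply integral_congr_ae
    filter_upwards [ae_ne y] with x hx
    simp only [ds_ne hx]; ring
  unfold TT
  rw [this, integral_zero]
  ring

lemma TT_X {f : ℝ → ℝ} (hf : Differentiable ℝ f) (y : ℝ) :
    TT (fun x => x * f x) y = y * TT f y + cc f := by
  have : ∫ x, dslope (fun x => x * f x) y x * (1 - x ^ 2) ∂measureT =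
      ∫ x, (f x * (1 - x ^ 2) + y * (dslope f y x * (1 - x ^ 2))) ∂measureT := by
    apply integral_congr_ae
    filter_upwards [ae_ne y] with x hx
    simp only [ds_ne hx]
    have := sub_ne_zero.2 hx
    field_simp; ring
  unfold TT cc
  rw [this, integral_add (integ (by have := hf.continuous; fun_prop)) ((integ_ds hf y).const_mul y),
    integral_const_mul]
  ring

/-- polynomial versions -/
noncomputable def tp (p : ℝ[X]) (y : ℝ) : ℝ := TT (fun x => p.eval x) y
noncomputable def cp (p : ℝ[X]) : ℝ := cc (fun x => p.eval x)

lemma tp_add (p q : ℝ[X]) (y : ℝ) : tp (p + q) y = tp p y + tp q y := by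
  unfold tp
  simp only [eval_add]
  exact TT_add p.differentiable q.differentiable y

lemma tp_smul (a : ℝ) (p : ℝ[X]) (y : ℝ) : tp (a • p) y = a * tp p y := by
  unfold tp
  simp only [eval_smul, smul_eq_mul]
  exact TT_smul _ _ _

lemma tp_C (a : ℝ) (y : ℝ) : tp (C a) y = - Real.pi * a * y := by
  have : (C a : ℝ[X]) = a • 1 := by rw [smul_eq_C_mul, mul_one]
  rw [this, tp_smul]
  unfold tp
  simp only [eval_one]
  rw [TT_one]; ring

lemma tp_X (p : ℝ[X]) (y : ℝ) : tp (X * p) y = y * tp p y + cp p := by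
  unfold tp cp
  simp only [eval_mul, eval_X]
  exact TT_X p.differentiable y

lemma tp_poly (p : ℝ[X]) : ∃ q : ℝ[X], ∀ y, tp p y = q.eval y := by
  induction p using Polynomial.induction_on with
  | C a => exact ⟨C (-Real.pi * a) * X, fun y => by simp [tp_C]⟩
  | add p q hp hq =>
    obtain ⟨a, ha⟩ := hp
    obtain ⟨b, hb⟩ := hq
    exact ⟨a + b, fun y => by simp [tp_add, ha, hb]⟩
  | monomial n a h =>
    obtain ⟨b, hb⟩ := h
    refine ⟨X * b + C (cp (C a * X ^ n)), fun y => ?_⟩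
    rw [show (C a * X ^ (n+1) : ℝ[X]) = X * (C a * X ^ n) by ring, tp_X, hb]
    simp

lemma tp_cont (p : ℝ[X]) : Continuous (tp p) := by
  obtain ⟨q, hq⟩ := tp_poly p
  rw [show tp p = fun y => q.eval y from funext hq]
  exact q.continuous

lemma tp_U (n : ℕ) (hc : ∀ n : ℕ, n ≠ 0 → cp (U ℝ n) = 0) (hc0 : cp (U ℝ 0) = Real.pi / 2) :
    ∀ y, tp (U ℝ n) y = - Real.pi * (T ℝ (n + 1)).eval y := by
  have h0 : ∀ y, tp (U ℝ 0) y = - Real.pi * y := by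
    intro y
    have := tp_C 1 y
    simpa using this
  have h1 : ∀ y, tp (U ℝ 1) y = - Real.pi * (T ℝ 2).eval y := by
    intro y
    have : (U ℝ 1 : ℝ[X]) = (2:ℝ) • (X * U ℝ 0) := by
      rw [smul_eq_C_mul, show (Polynomial.C 2 : ℝ[X]) = 2 from rfl]; simp
    rw [this, tp_smul, tp_X, h0, hc0]
    simp [T_two]; ring
  induction n using Nat.twoStepInduction with
  | zero => simpa using h0
  | one => intro y; simpa [one_add_one_eq_two] using h1 y
  | more n ih1 ih2 =>
    intro y
    have : (U ℝ ((n + 2 : ℕ) : ℤ) : ℝ[X]) = (2:ℝ) • (X * U ℝ ((n + 1 : ℕ) : ℤ)) + (-1 : ℝ) • U ℝ (n : ℤ) := by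
      push_cast
      rw [U_add_two, smul_eq_C_mul, smul_eq_C_mul, show (Polynomial.C 2 : ℝ[X]) = 2 from rfl]; simp; ring
    rw [this, tp_add, tp_smul, tp_smul, tp_X, ih1, ih2, hc _ (by omega)]
    push_cast
    rw [show (n : ℤ) + 2 + 1 = (n + 1) + 2 by ring, T_add_two]
    simp; ring

lemma cp_U (n : ℕ) : cp (U ℝ n) = (1/2) * (∫ x, (T ℝ n).eval x ∂measureT - ∫ x, (T ℝ (n+2)).eval x ∂measureT) := by
  unfold cp cc
  rw [← integral_sub (integ (T ℝ n).continuous) (integ (T ℝ (n+2)).continuous), ← integral_const_mul]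
  congr 1
  ext x
  have h1 := congrArg (eval x) (one_sub_X_sq_mul_U_eq_pol_in_T ℝ n)
  have h2 := congrArg (eval x) (T_add_two ℝ n)
  simp only [eval_mul, eval_sub, eval_one, eval_pow, eval_X, eval_ofNat] at h1 h2
  linarith

lemma cp_U_ne (n : ℕ) (hn : n ≠ 0) : cp (U ℝ n) = 0 := by
  rw [cp_U, integral_eval_T_real_measureT_of_ne_zero (by exact_mod_cast hn),
    integral_eval_T_real_measureT_of_ne_zero (by omega)]
  simp

lemma cp_U_zero : cp (U ℝ 0) = Real.pi / 2 := by
  have := cp_U 0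
  simp only [Nat.cast_zero] at this
  rw [this, integral_eval_T_real_measureT_zero,
    integral_eval_T_real_measureT_of_ne_zero (by omega)]
  ring

lemma span_U (p : ℝ[X]) : p ∈ Submodule.span ℝ (Set.range fun n : ℕ => U ℝ (n : ℤ)) := by
  set S := Submodule.span ℝ (Set.range fun n : ℕ => U ℝ (n : ℤ)) with hS
  have hU : ∀ n : ℕ, U ℝ (n : ℤ) ∈ S := fun n => Submodule.subset_span ⟨n, rfl⟩
  have hX : ∀ p ∈ S, X * p ∈ S := by
    intro p hp
    induction hp using Submodule.span_induction with
    | mem p h =>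
      obtain ⟨n, rfl⟩ := h
      rcases n with _ | n
      · have : (X * U ℝ ((0 : ℕ) : ℤ) : ℝ[X]) = (1/2 : ℝ) • U ℝ ((1 : ℕ) : ℤ) := by
          rw [smul_eq_C_mul]; simp
          rw [← mul_assoc, show (2 : ℝ[X]) = C 2 from rfl, ← Polynomial.C_mul]; norm_num
        simp only
        rw [this]
        exact S.smul_mem _ (hU 1)
      · have : (X * U ℝ ((n + 1 : ℕ) : ℤ) : ℝ[X]) = (1/2 : ℝ) • (U ℝ ((n + 2 : ℕ) : ℤ) + U ℝ (n : ℤ)) := by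
          push_cast
          rw [U_add_two, smul_eq_C_mul]
          rw [sub_add_cancel, mul_assoc, ← mul_assoc, show (2 : ℝ[X]) = C 2 from rfl, ← Polynomial.C_mul]; norm_num
        simp only
        rw [this]
        exact S.smul_mem _ (S.add_mem (hU _) (hU _))
    | zero => simp
    | add a b _ _ ha hb => rw [mul_add]; exact S.add_mem ha hb
    | smul c a _ ha => rw [mul_smul_comm]; exact S.smul_mem _ ha
  induction p using Polynomial.induction_on with
  | C a =>
    have : (C a : ℝ[X]) = a • U ℝ ((0:ℕ):ℤ) := by rw [smul_eq_C_mul]; simp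
    rw [this]; exact S.smul_mem _ (hU 0)
  | add p q hp hq => exact S.add_mem hp hq
  | monomial n a h =>
    rw [show (C a * X ^ (n+1) : ℝ[X]) = X * (C a * X ^ n) by ring]
    exact hX _ h

lemma Z_zero (p : ℝ[X]) : ∫ y, tp p y ∂measureT = 0 := by
  have := span_U p
  induction this using Submodule.span_induction with
  | mem p h =>
    obtain ⟨n, rfl⟩ := h
    simp only [tp_U n cp_U_ne cp_U_zero]
    rw [integral_const_mul, integral_eval_T_real_measureT_of_ne_zero (by omega), mul_zero]
  | zero =>
    have : ∀ y, tp 0 y = 0 := fun y => by simpa using tp_C 0 y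
    simp [this]
  | add a b _ _ ha hb =>
    simp only [tp_add]
    rw [integral_add (integ (tp_cont a)) (integ (tp_cont b)), ha, hb, add_zero]
  | smul c a _ ha =>
    simp only [tp_smul]
    rw [integral_const_mul, ha, mul_zero]

lemma iso (p : ℝ[X]) : ∀ q : ℝ[X], ∫ y, tp p y * tp q y ∂measureT =
    Real.pi ^ 2 * ∫ y, p.eval y * q.eval y * (1 - y ^ 2) ∂measureT := by
  have key : ∀ q : ℝ[X], ∫ y, y * tp q y ∂measureT = - Real.pi * cp q := by
    intro q
    have h := Z_zero (X * q)
    simp only [tp_X] at h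
    have hc := tp_cont q
    rw [integral_add (integ (by fun_prop)) (integrable_const _)] at h
    have hm : ∫ _y : ℝ, cp q ∂measureT = Real.pi * cp q := by
      rw [← mass, ← integral_mul_const]; simp
    linarith
  induction p using Polynomial.induction_on with
  | C a =>
    intro q
    simp only [tp_C, eval_C, mul_assoc]
    rw [integral_const_mul, integral_const_mul, integral_const_mul, key]
    unfold cp cc
    ring
  | add p r hp hr =>
    intro q
    have h1 := tp_cont p
    have h2 := tp_cont q
    have h3 := tp_cont r
    simp only [tp_add, eval_add, add_mul]
    rw [integral_add (integ (by fun_prop)) (integ (by fun_prop)),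
      integral_add (integ (by fun_prop)) (integ (by fun_prop)), hp, hr]
    ring
  | monomial n a h =>
    intro q
    rw [show (C a * X ^ (n+1) : ℝ[X]) = X * (C a * X ^ n) by ring]
    have h0 := h (X * q)
    set p := (C a * X ^ n : ℝ[X])
    have h1 := tp_cont p
    have h2 := tp_cont q
    simp only [tp_X] at h0 ⊢
    have e1 : ∫ y, (y * tp p y + cp p) * tp q y ∂measureT =
        ∫ y, y * tp p y * tp q y ∂measureT := by
      have : ∀ y, (y * tp p y + cp p) * tp q y = y * tp p y * tp q y + cp p * tp q y := fun y => by ring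
      simp only [this]
      rw [integral_add (integ (by fun_prop)) (integ (by fun_prop)), integral_const_mul, Z_zero]
      ring
    have e2 : ∫ y, tp p y * (y * tp q y + cp q) ∂measureT =
        ∫ y, y * tp p y * tp q y ∂measureT := by
      have : ∀ y, tp p y * (y * tp q y + cp q) = y * tp p y * tp q y + cp q * tp p y := fun y => by ring
      simp only [this]
      rw [integral_add (integ (by fun_prop)) (integ (by fun_prop)), integral_const_mul, Z_zero]
      ring
    rw [e1, ← e2, h0]
    congr 2
    ext y
    simp only [eval_mul, eval_X]; ring

lemma surj (p : ℝ[X]) : ∃ (c : ℝ) (q : ℝ[X]), ∀ y, p.eval y = c + tp q y := by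
  induction p using Polynomial.induction_on with
  | C a => exact ⟨a, 0, fun y => by simpa using (tp_C 0 y)⟩
  | add p r hp hr =>
    obtain ⟨c, q, h⟩ := hp
    obtain ⟨c', q', h'⟩ := hr
    exact ⟨c + c', q + q', fun y => by rw [eval_add, h, h', tp_add]; ring⟩
  | monomial n a h =>
    obtain ⟨c, q, h⟩ := h
    refine ⟨- cp q, X * q + C (- c / Real.pi), fun y => ?_⟩
    rw [show (C a * X ^ (n+1) : ℝ[X]) = X * (C a * X ^ n) by ring, eval_mul, h, tp_add, tp_X, tp_C]
    have := Real.pi_ne_zero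
    simp
    field_simp
    ring

end EqPV

namespace EqPV
open MeasureTheory Polynomial Polynomial.Chebyshev

noncomputable def Sq (x : ℝ) : ℝ := √(1 - x ^ 2)

lemma Sq_cont : Continuous Sq := by unfold Sq; fun_prop

lemma Sq_pos {x : ℝ} (hx : x ∈ Set.Ioo (-1 : ℝ) 1) : 0 < Sq x := by
  unfold Sq; apply Real.sqrt_pos.2; nlinarith [hx.1, hx.2]

lemma Sq_sq {x : ℝ} (hx : x ∈ Set.Icc (-1 : ℝ) 1) : Sq x ^ 2 = 1 - x ^ 2 := by
  unfold Sq; apply Real.sq_sqrt; nlinarith [hx.1, hx.2]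

lemma Sq_deriv {x : ℝ} (hx : x ∈ Set.Ioo (-1 : ℝ) 1) : HasDerivAt Sq (- x / Sq x) x := by
  have h1 : HasDerivAt (fun x : ℝ => 1 - x ^ 2) (-(2 * x)) x := by
    simpa using (hasDerivAt_pow 2 x).const_sub 1
  have := h1.sqrt (by nlinarith [hx.1, hx.2])
  have hp := Sq_pos hx
  unfold Sq at *
  convert! this using 1
  field_simp

lemma K_int {x : ℝ} (hx : x ∈ Set.Ioo (-1 : ℝ) 1) :
    ∫ l in (-1 : ℝ)..1, dslope Sq x l =
      - Real.pi * x - Sq x * (Real.log (1 - x) - Real.log (1 + x)) := by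
  have hs := Sq_pos hx
  have hs2 := Sq_sq (Set.Ioo_subset_Icc_self hx)
  have hD : ∀ l ∈ Set.Icc (-1 : ℝ) 1, 0 < 1 - x * l + Sq x * Sq l := by
    intro l hl
    have : 0 ≤ Sq l := Real.sqrt_nonneg _
    have : 0 < 1 - x * l := by
      rcases le_total 0 x with h | h
      · nlinarith [hl.1, hl.2, hx.1, hx.2, mul_nonneg h (sub_nonneg.2 hl.2)]
      · nlinarith [hl.1, hl.2, hx.1, hx.2, mul_nonneg (neg_nonneg.2 h) (neg_le_iff_add_nonneg.1 hl.1)]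
    positivity
  have hcont := cont_dslope Sq_cont (Sq_deriv hx).differentiableAt
  have := MeasureTheory.integral_eq_of_hasDerivAt_off_countable_of_le
    (fun l => Sq l - x * Real.arcsin l - Sq x * Real.log (1 - x * l + Sq x * Sq l))
    (dslope Sq x) (a := -1) (b := 1) (by norm_num) (Set.countable_singleton x) ?_ ?_
    (hcont.intervalIntegrable _ _)
  · rw [this]
    simp [Sq]
    ring
  · have h1 := Sq_cont
    refine ContinuousOn.sub (by have := Real.continuous_arcsin; fun_prop)
      (continuousOn_const.mul (ContinuousOn.log (by fun_prop) fun l hl => (hD l hl).ne'))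
  · intro l hl
    have hl' := hl.1
    have hne : l ≠ x := hl.2
    have ht := Sq_pos hl'
    have ht2 := Sq_sq (Set.Ioo_subset_Icc_self hl')
    have hDl := hD l (Set.Ioo_subset_Icc_self hl')
    have d1 := Sq_deriv hl'
    have d2 := Real.hasDerivAt_arcsin hl'.1.ne' hl'.2.ne
    have d3 := ((((hasDerivAt_id l).const_mul x).const_sub 1).add (d1.const_mul (Sq x))).log hDl.ne'
    have := (d1.sub (d2.const_mul x)).sub (d3.const_mul (Sq x))
    convert! this using 1
    rw [ds_ne hne]
    change _ = -l / Sq l - x * (1 / Sq l) - Sq x * ((-(x * 1) + Sq x * (-l / Sq l)) / (1 - x * l + Sq x * Sq l))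
    have h0 : l - x ≠ 0 := sub_ne_zero.2 hne
    have h1 := hDl.ne'
    generalize Sq l = t at *
    generalize Sq x = s at *
    have h2 := ht.ne'
    obtain ⟨D, hDe⟩ : ∃ D, D = 1 - x * l + s * t := ⟨_, rfl⟩
    rw [← hDe] at h1 ⊢
    field_simp
    have e1 : l ^ 2 = 1 - t ^ 2 := by linarith
    have e2 : x ^ 2 = 1 - s ^ 2 := by linarith
    rw [hDe]
    linear_combination (1 - x * l + s * t) * (e1 - e2) - s * (s * e1 - t * e2)

lemma h_split {f : ℝ → ℝ} {x : ℝ} {l : ℝ} (hne : l ≠ x) :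
    dslope (fun l => f l * Sq l) x l = dslope f x l * Sq l + f x * dslope Sq x l := by
  rw [ds_ne hne, ds_ne hne, ds_ne hne]
  have := sub_ne_zero.2 hne
  field_simp; ring

lemma h_cont {f : ℝ → ℝ} (hf : Differentiable ℝ f) {x : ℝ} (hx : x ∈ Set.Ioo (-1 : ℝ) 1) :
    Continuous (dslope (fun l => f l * Sq l) x) :=
  cont_dslope (hf.continuous.mul Sq_cont) ((hf x).mul (Sq_deriv hx).differentiableAt)

lemma h_int {f : ℝ → ℝ} (hf : Differentiable ℝ f) {x : ℝ} (hx : x ∈ Set.Ioo (-1 : ℝ) 1) :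
    ∫ l in (-1 : ℝ)..1, dslope (fun l => f l * Sq l) x l =
      TT f x - f x * Sq x * (Real.log (1 - x) - Real.log (1 + x)) := by
  have c1 := cont_dslope hf.continuous (hf x)
  have c2 := cont_dslope Sq_cont (Sq_deriv hx).differentiableAt
  have c3 := Sq_cont
  have : ∫ l in (-1 : ℝ)..1, dslope (fun l => f l * Sq l) x l =
      ∫ l in (-1 : ℝ)..1, (dslope f x l * Sq l + f x * dslope Sq x l) := by
    apply intervalIntegral.integral_congr_ae
    filter_upwards [Measure.ae_ne volume x] with l hl _
    exact h_split hl
  rw [this, intervalIntegral.integral_add (Continuous.intervalIntegrable (by fun_prop) _ _)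
    (Continuous.intervalIntegrable (by fun_prop) _ _), intervalIntegral.integral_const_mul, K_int hx]
  have := int_sqrt (dslope f x)
  unfold TT
  rw [← this]
  unfold Sq
  ring

lemma PV {f : ℝ → ℝ} (hf : Differentiable ℝ f) {x : ℝ} (hx : x ∈ Set.Ioo (-1 : ℝ) 1) :
    Tendsto (fun ε : ℝ =>
        (∫ l in (-1 : ℝ)..(x - ε), f l * √(1 - l ^ 2) / (l - x)) +
          ∫ l in (x + ε)..(1 : ℝ), f l * √(1 - l ^ 2) / (l - x))
      (nhdsWithin 0 (Set.Ioi 0)) (nhds (TT f x)) := by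
  set h : ℝ → ℝ := fun l => f l * Sq l with hh
  have hc := h_cont hf hx
  have hi := h_int hf hx
  rw [← hh] at hc hi
  have ii : ∀ a b, IntervalIntegrable (dslope h x) volume a b := fun a b => hc.intervalIntegrable _ _
  have lim : Tendsto (fun ε : ℝ => (∫ l in (-1 : ℝ)..(x - ε), dslope h x l) +
      (∫ l in (x + ε)..(1 : ℝ), dslope h x l) + h x * (Real.log (1 - x) - Real.log (1 + x)))
      (nhdsWithin 0 (Set.Ioi 0)) (nhds (TT f x)) := by
    have c1 : Continuous (fun u => ∫ l in (-1 : ℝ)..u, dslope h x l) :=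
      intervalIntegral.continuous_primitive ii _
    have e : (fun ε : ℝ => (∫ l in (-1 : ℝ)..(x - ε), dslope h x l) +
      (∫ l in (x + ε)..(1 : ℝ), dslope h x l) + h x * (Real.log (1 - x) - Real.log (1 + x))) =
      fun ε : ℝ => (∫ l in (-1 : ℝ)..(x - ε), dslope h x l) +
      ((∫ l in (-1 : ℝ)..1, dslope h x l) - ∫ l in (-1 : ℝ)..(x + ε), dslope h x l) + h x * (Real.log (1 - x) - Real.log (1 + x)) := by
      ext ε
      rw [intervalIntegral.integral_interval_sub_left (ii _ _) (ii _ _)]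
    rw [e]
    have c2 : Continuous (fun ε : ℝ => (∫ l in (-1 : ℝ)..(x - ε), dslope h x l) +
      ((∫ l in (-1 : ℝ)..1, dslope h x l) - ∫ l in (-1 : ℝ)..(x + ε), dslope h x l) + h x * (Real.log (1 - x) - Real.log (1 + x))) := by
      have a1 := c1.comp (show Continuous fun ε : ℝ => x - ε by fun_prop)
      have a2 := c1.comp (show Continuous fun ε : ℝ => x + ε by fun_prop)
      exact (a1.add (continuous_const.sub a2)).add continuous_const
    have := (c2.tendsto 0).mono_left (nhdsWithin_le_nhds (s := Set.Ioi 0))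
    convert! this using 2
    rw [hi]; simp [hh]
  refine lim.congr' ?_
  have hsmall : ∀ᶠ ε in nhdsWithin (0:ℝ) (Set.Ioi 0), ε < min (1 - x) (1 + x) :=
    nhdsWithin_le_nhds (Iio_mem_nhds (lt_min (by linarith [hx.2]) (by linarith [hx.1])))
  filter_upwards [hsmall, self_mem_nhdsWithin] with ε h1 h2
  have h2 : 0 < ε := h2
  have h3 := lt_of_lt_of_le h1 (min_le_left _ _)
  have h4 := lt_of_lt_of_le h1 (min_le_right _ _)
  have gen : ∀ a b, a ≤ b → x ∉ Set.Icc a b → (∫ l in a..b, f l * √(1 - l ^ 2) / (l - x)) =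
      (∫ l in a..b, dslope h x l) + h x * (Real.log (b - x) - Real.log (a - x)) := by
    intro a b hab hxab
    have hne : ∀ l ∈ Set.uIcc a b, l - x ≠ 0 := by
      intro l hl
      rw [Set.uIcc_of_le hab] at hl
      intro h0
      apply hxab
      rwa [← sub_eq_zero.1 h0]
    have ci : IntervalIntegrable (fun l => (l - x)⁻¹) volume a b := by
      apply ContinuousOn.intervalIntegrable
      exact ContinuousOn.inv₀ (by fun_prop) hne
    have hlog : ∫ l in a..b, (l - x)⁻¹ = Real.log (b - x) - Real.log (a - x) := by
      rw [intervalIntegral.integral_comp_sub_right (fun l => l⁻¹) x, integral_inv]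
      · rw [Real.log_div]
        · exact hne b Set.right_mem_uIcc
        · exact hne a Set.left_mem_uIcc
      · intro h0
        rw [Set.uIcc_of_le (by linarith)] at h0
        exact hxab ⟨by linarith [h0.1], by linarith [h0.2]⟩
    rw [← hlog, ← intervalIntegral.integral_const_mul, ← intervalIntegral.integral_add (ii _ _) (ci.const_mul _)]
    apply intervalIntegral.integral_congr
    intro l hl
    have := hne l hl
    simp only
    rw [ds_ne (sub_ne_zero.1 this), hh]
    simp only [Sq]
    field_simp
    ring
  rw [gen _ _ (by linarith) (fun h => by linarith [h.2]), gen _ _ (by linarith) (fun h => by linarith [h.1])]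
  rw [show x - ε - x = -ε by ring, show x + ε - x = ε by ring, show -1 - x = -(1 + x) by ring,
    Real.log_neg_eq_log, Real.log_neg_eq_log]
  ring
end EqPV

namespace EqPV
open MeasureTheory Polynomial Polynomial.Chebyshev

lemma integ_iff (f : ℝ → ℝ) : Integrable f measureT ↔
    IntervalIntegrable (fun x => f x * √((1 - x ^ 2)⁻¹)) volume (-1) 1 := by
  rw [intervalIntegrable_iff, Set.uIoc_of_le (by norm_num), measureT,
    restrict_withDensity (by measurability),
    integrable_withDensity_iff (by fun_prop) (by simp)]
  unfold IntegrableOn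
  rfl

noncomputable def uq (q : ℝ[X]) (x : ℝ) : ℝ := q.derivative.eval x * (1 - x ^ 2) - x * q.eval x

lemma uq_cont (q : ℝ[X]) : Continuous (uq q) := by unfold uq; fun_prop

lemma h_deriv (q : ℝ[X]) {x : ℝ} (hx : x ∈ Set.Ioo (-1 : ℝ) 1) :
    HasDerivAt (fun l => q.eval l * Sq l) (uq q x * √((1 - x ^ 2)⁻¹)) x := by
  have := (q.hasDerivAt x).mul (Sq_deriv hx)
  convert! this using 1
  have h1 := Sq_pos hx
  have h2 := Sq_sq (Set.Ioo_subset_Icc_self hx)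
  rw [Real.sqrt_inv]
  change _ * (Sq x)⁻¹ = _
  unfold uq
  rw [← h2]
  field_simp
  ring

lemma logIBP (q : ℝ[X]) {y : ℝ} (hy : y ∈ Set.Ioo (-1 : ℝ) 1)
    (hint : Integrable (fun x => Real.log (x - y) * uq q x) measureT) :
    ∫ x, Real.log (x - y) * uq q x ∂measureT = - tp q y := by
  have hi := (integ_iff _).1 hint
  rw [integral_measureT]
  set h : ℝ → ℝ := fun l => q.eval l * Sq l with hh
  have hc : Continuous (dslope h y) := h_cont q.differentiable hy
  have hI : ∫ l in (-1 : ℝ)..1, dslope h y l = _ := h_int q.differentiable hy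
  have ii : IntervalIntegrable (dslope h y) volume (-1) 1 := hc.intervalIntegrable _ _
  have key := MeasureTheory.integral_eq_of_hasDerivAt_off_countable_of_le
    (fun l => (h l - h y) * Real.log (l - y))
    (fun l => Real.log (l - y) * uq q l * √((1 - l ^ 2)⁻¹) + dslope h y l)
    (a := -1) (b := 1) (by norm_num) (Set.countable_singleton y) ?_ ?_ (hi.add ii)
  · rw [intervalIntegral.integral_add hi ii, hI] at key
    simp only [hh, Sq] at key
    rw [show -1 - y = -(1 + y) by ring, Real.log_neg_eq_log] at key
    norm_num at key
    unfold tp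
    norm_num
    linarith
  · apply Continuous.continuousOn
    have : (fun l => (h l - h y) * Real.log (l - y)) =
        fun l => dslope h y l * ((l - y) * Real.log (l - y)) := by
      ext l
      rcases eq_or_ne l y with rfl | hne
      · simp
      · rw [ds_ne hne]
        have := sub_ne_zero.2 hne
        field_simp
    rw [this]
    exact hc.mul (Real.continuous_mul_log.comp (by fun_prop))
  · intro l hl
    have hne : l ≠ y := hl.2
    have h0 := sub_ne_zero.2 hne
    have := ((h_deriv q hl.1).sub_const (h y)).mul (((hasDerivAt_id l).sub_const y).log h0)
    convert! this using 1
    rw [ds_ne hne]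
    simp only [id, hh]
    field_simp

lemma log_prod : Integrable (fun z : ℝ × ℝ => Real.log (z.1 - z.2))
    (measureT.prod (volume.restrict (Set.Ioc (-1 : ℝ) 1))) := by
  have hm : AEStronglyMeasurable (fun z : ℝ × ℝ => Real.log (z.1 - z.2))
    (measureT.prod (volume.restrict (Set.Ioc (-1 : ℝ) 1))) :=
    (Real.measurable_log.comp (measurable_fst.sub measurable_snd)).aestronglyMeasurable
  have sec : ∀ x : ℝ, IntervalIntegrable (fun y => Real.log (x - y)) volume (-1) 1 := by
    intro x
    have := (intervalIntegral.intervalIntegrable_log' (a := x + 1) (b := x - 1)).comp_sub_left x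
    simpa using this
  rw [integrable_prod_iff hm]
  constructor
  · refine Eventually.of_forall fun x => ?_
    exact (intervalIntegrable_iff_integrableOn_Ioc_of_le (by norm_num)).1 (sec x)
  · refine Integrable.of_bound hm.norm.integral_prod_right' (∫ u in (-2 : ℝ)..2, ‖Real.log u‖) ?_
    filter_upwards [ae_mem] with x hx
    rw [Real.norm_of_nonneg (integral_nonneg fun _ => norm_nonneg _),
      ← intervalIntegral.integral_of_le (by norm_num)]
    rw [intervalIntegral.integral_comp_sub_left (fun u => ‖Real.log u‖) x]
    apply intervalIntegral.integral_mono_interval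
    · linarith [hx.1]
    · linarith
    · linarith [hx.2]
    · exact Eventually.of_forall fun _ => norm_nonneg _
    · exact intervalIntegral.intervalIntegrable_log'.norm

lemma bdd (f : ℝ → ℝ) (hf : Continuous f) : ∃ C, ∀ x ∈ Set.Icc (-1 : ℝ) 1, ‖f x‖ ≤ C :=
  isCompact_Icc.exists_bound_of_continuousOn hf.continuousOn

lemma EL_int (V d : ℝ → ℝ) (ℓ : ℝ) (hV : ContDiff ℝ 1 V) (hd : Continuous d)
    (hEL : ∀ x ∈ Set.Icc (-1 : ℝ) 1,
      2 * ∫ y in (-1 : ℝ)..1, Real.log |x - y| * (d y * Real.sqrt (1 - y ^ 2))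
        = V x + ℓ) (q : ℝ[X]) :
    ∫ x, deriv V x * q.eval x * (1 - x ^ 2) ∂measureT =
      2 * ∫ y, d y * tp q y * (1 - y ^ 2) ∂measureT := by
  set ν := (volume.restrict (Set.Ioc (-1 : ℝ) 1)) with hν
  have hu := uq_cont q
  have hG : Integrable (fun z : ℝ × ℝ => Real.log (z.1 - z.2) * uq q z.1) (measureT.prod ν) := by
    obtain ⟨C, hC⟩ := bdd _ hu
    refine log_prod.mul_bdd (c := C) (hu.comp continuous_fst).aestronglyMeasurable ?_
    have := (Measure.quasiMeasurePreserving_fst (μ := measureT) (ν := ν)).ae ae_mem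
    filter_upwards [this] with z hz
    exact hC _ (Set.Ioo_subset_Icc_self hz)
  have hρ : Continuous (fun y => d y * Sq y) := hd.mul Sq_cont
  have hνm : ∀ᵐ y ∂ν, y ∈ Set.Ioo (-1 : ℝ) 1 := by
    have h1 : ∀ᵐ y ∂ν, y ∈ Set.Ioc (-1 : ℝ) 1 := ae_restrict_mem measurableSet_Ioc
    filter_upwards [h1, Measure.ae_ne ν 1] with x hx h
    exact ⟨hx.1, lt_of_le_of_ne hx.2 h⟩
  have hF : Integrable (Function.uncurry fun x y : ℝ => Real.log (x - y) * uq q x * (d y * Sq y)) (measureT.prod ν) := by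
    obtain ⟨C, hC⟩ := bdd _ hρ
    refine hG.mul_bdd (c := C) (hρ.comp continuous_snd).aestronglyMeasurable ?_
    have := (Measure.quasiMeasurePreserving_snd (μ := measureT) (ν := ν)).ae hνm
    filter_upwards [this] with z hz
    exact hC _ (Set.Ioo_subset_Icc_self hz)
  have swap := integral_integral_swap hF
  have L : ∫ x, ∫ y, Real.log (x - y) * uq q x * (d y * Sq y) ∂ν ∂measureT =
      (1 / 2) * ∫ x, (V x + ℓ) * uq q x ∂measureT := by
    rw [← integral_const_mul]
    apply integral_congr_ae
    filter_upwards [ae_mem] with x hx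
    rw [← hEL x (Set.Ioo_subset_Icc_self hx), intervalIntegral.integral_of_le (by norm_num)]
    have : ∀ y, Real.log (x - y) * uq q x * (d y * Sq y) = uq q x * (Real.log |x - y| * (d y * √(1 - y ^ 2))) := by
      intro y
      rw [Real.log_abs]; unfold Sq; ring
    simp only [this]
    rw [integral_const_mul]
    ring
  have R : ∫ y, ∫ x, Real.log (x - y) * uq q x * (d y * Sq y) ∂measureT ∂ν =
      - ∫ y, d y * tp q y * (1 - y ^ 2) ∂measureT := by
    rw [← int_sqrt, intervalIntegral.integral_of_le (by norm_num), ← integral_neg]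
    apply integral_congr_ae
    filter_upwards [hνm, hG.prod_left_ae] with y hy hi
    rw [integral_mul_const, logIBP q hy hi]
    unfold Sq; ring
  have I : ∫ x, (V x + ℓ) * uq q x ∂measureT = - ∫ x, deriv V x * q.eval x * (1 - x ^ 2) ∂measureT := by
    rw [← int_sqrt, integral_measureT]
    have hV1 : Continuous (deriv V) := hV.continuous_deriv (by norm_num)
    have hSq := Sq_cont
    have hVc := hV.continuous
    have i1 : IntervalIntegrable (fun x => (V x + ℓ) * uq q x * √((1 - x ^ 2)⁻¹)) volume (-1) 1 :=
      (integ_iff _).1 (integ (by fun_prop))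
    have i2 : IntervalIntegrable (fun x => deriv V x * q.eval x * √(1 - x ^ 2)) volume (-1) 1 :=
      Continuous.intervalIntegrable (by fun_prop) _ _
    have key := MeasureTheory.integral_eq_of_hasDerivAt_off_countable_of_le
      (fun l => (V l + ℓ) * (q.eval l * Sq l))
      (fun x => (V x + ℓ) * uq q x * √((1 - x ^ 2)⁻¹) + deriv V x * q.eval x * √(1 - x ^ 2))
      (a := -1) (b := 1) (by norm_num) Set.countable_empty (by fun_prop) ?_ (i1.add i2)
    · rw [intervalIntegral.integral_add i1 i2] at key
      norm_num [Sq] at key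
      norm_num
      linarith
    · intro x hx
      have := (((hV.differentiable (by norm_num) x).hasDerivAt).add_const ℓ).mul (h_deriv q hx.1)
      convert! this using 1
      unfold Sq; ring
  rw [L, R, I] at swap
  linarith
end EqPV

namespace EqPV
open MeasureTheory Polynomial Polynomial.Chebyshev

lemma integ_mul {f g : ℝ → ℝ} (hf : ContinuousOn f (Set.Icc (-1) 1))
    (hg : ContinuousOn g (Set.Icc (-1) 1)) : Integrable (fun x => f x * g x) measureT :=
  integrable_measureT (hf.mul hg)

lemma antider (r : ℝ[X]) : ∃ p : ℝ[X], p.derivative = r := by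
  induction r using Polynomial.induction_on' with
  | add p q hp hq =>
    obtain ⟨a, ha⟩ := hp
    obtain ⟨b, hb⟩ := hq
    exact ⟨a + b, by simp [ha, hb]⟩
  | monomial n a =>
    refine ⟨monomial (n + 1) (a / (n + 1)), ?_⟩
    rw [derivative_monomial]
    have : (n : ℝ) + 1 ≠ 0 := by positivity
    simp
    field_simp

lemma approx {f : ℝ → ℝ} (hf : ContDiff ℝ 1 f) {ε : ℝ} (hε : 0 < ε) : ∃ p : ℝ[X],
    (∀ x ∈ Set.Icc (-1 : ℝ) 1, |f x - p.eval x| ≤ ε) ∧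
    (∀ x ∈ Set.Icc (-1 : ℝ) 1, ∀ y ∈ Set.Icc (-1 : ℝ) 1,
      |(f x - p.eval x) - (f y - p.eval y)| ≤ ε * |x - y|) := by
  have hf1 : Continuous (deriv f) := hf.continuous_deriv (by norm_num)
  obtain ⟨r, hr⟩ := exists_polynomial_near_of_continuousOn (-1) 1 (deriv f) hf1.continuousOn ε hε
  obtain ⟨p0, hp0⟩ := antider r
  set p := p0 + C (f 0 - p0.eval 0) with hp
  have hpd : p.derivative = r := by simp [hp, hp0]
  have lip : ∀ x ∈ Set.Icc (-1 : ℝ) 1, ∀ y ∈ Set.Icc (-1 : ℝ) 1,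
      |(f x - p.eval x) - (f y - p.eval y)| ≤ ε * |x - y| := by
    intro x hx y hy
    have := (convex_Icc (-1 : ℝ) 1).norm_image_sub_le_of_norm_hasDerivWithin_le
      (f := fun x => f x - p.eval x) (f' := fun x => deriv f x - r.eval x) (C := ε) ?_ ?_ hy hx
    · simpa [Real.norm_eq_abs] using this
    · intro z _
      rw [← hpd]
      exact (((hf.differentiable (by norm_num) z).hasDerivAt).sub (p.hasDerivAt z)).hasDerivWithinAt
    · intro z hz
      rw [Real.norm_eq_abs, abs_sub_comm]
      exact (hr z hz).le
  refine ⟨p, fun x hx => ?_, lip⟩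
  have := lip x hx 0 (by norm_num)
  have h0 : f 0 - p.eval 0 = 0 := by simp [hp]
  rw [h0, sub_zero, sub_zero] at this
  have hx1 : |x| ≤ 1 := abs_le.2 hx
  nlinarith

lemma mass' : measureT.real Set.univ = Real.pi := by
  simpa using mass

lemma int_bound {f : ℝ → ℝ} {c : ℝ} (h : ∀ x ∈ Set.Icc (-1 : ℝ) 1, |f x| ≤ c) :
    |∫ x, f x ∂measureT| ≤ c * Real.pi := by
  have := norm_integral_le_of_norm_le_const (μ := measureT) (f := f) (C := c) (by
    filter_upwards [ae_mem] with x hx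
    exact h x (Set.Ioo_subset_Icc_self hx))
  rwa [mass', Real.norm_eq_abs] at this

lemma TT_bound {g : ℝ → ℝ} {ε : ℝ} (hε : 0 < ε)
    (h1 : ∀ x ∈ Set.Icc (-1 : ℝ) 1, |g x| ≤ ε)
    (h2 : ∀ x ∈ Set.Icc (-1 : ℝ) 1, ∀ y ∈ Set.Icc (-1 : ℝ) 1, |g x - g y| ≤ ε * |x - y|)
    {y : ℝ} (hy : y ∈ Set.Icc (-1 : ℝ) 1) : |TT g y| ≤ 2 * Real.pi * ε := by
  have b1 : |∫ x, dslope g y x * (1 - x ^ 2) ∂measureT| ≤ ε * Real.pi := by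
    have := norm_integral_le_of_norm_le_const (μ := measureT)
      (f := fun x => dslope g y x * (1 - x ^ 2)) (C := ε) (by
      filter_upwards [ae_mem, ae_ne y] with x hx hne
      have hx' := Set.Ioo_subset_Icc_self hx
      rw [Real.norm_eq_abs, abs_mul, ds_ne hne, abs_div]
      have a1 : |g x - g y| / |x - y| ≤ ε := by
        rw [div_le_iff₀ (abs_pos.2 (sub_ne_zero.2 hne))]
        exact h2 x hx' y hy
      have a2 : |1 - x ^ 2| ≤ 1 := by
        rw [abs_le]; constructor <;> nlinarith [hx.1, hx.2]
      calc _ ≤ ε * 1 := mul_le_mul a1 a2 (abs_nonneg _) hε.le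
        _ = ε := mul_one _)
    rwa [mass', Real.norm_eq_abs] at this
  have b2 : |Real.pi * y * g y| ≤ Real.pi * ε := by
    rw [abs_mul, abs_mul, abs_of_pos Real.pi_pos]
    have hy1 : |y| ≤ 1 := abs_le.2 hy
    have := h1 y hy
    have : |y| * |g y| ≤ 1 * ε := mul_le_mul hy1 this (abs_nonneg _) (by norm_num)
    nlinarith [Real.pi_pos]
  unfold TT
  calc _ ≤ _ + _ := abs_sub _ _
    _ ≤ ε * Real.pi + Real.pi * ε := add_le_add b1 b2
    _ = _ := by ring

lemma approx2 {f : ℝ → ℝ} (hf : ContDiff ℝ 1 f) {ε : ℝ} (hε : 0 < ε) : ∃ p : ℝ[X],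
    (∀ x ∈ Set.Icc (-1 : ℝ) 1, |f x - p.eval x| ≤ ε) ∧
    (∀ x ∈ Set.Icc (-1 : ℝ) 1, |TT f x - tp p x| ≤ 2 * Real.pi * ε) := by
  obtain ⟨p, h1, h2⟩ := approx hf hε
  refine ⟨p, h1, fun x hx => ?_⟩
  have hfd : Differentiable ℝ f := hf.differentiable (by norm_num)
  have e := TT_add (f := fun x => f x - p.eval x) (g := fun x => p.eval x)
    (hfd.sub p.differentiable) p.differentiable x
  simp only [sub_add_cancel] at e
  have := TT_bound hε h1 h2 hx
  unfold tp
  rw [e, add_sub_cancel_right]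
  exact this

lemma TT_contOn {f : ℝ → ℝ} (hf : ContDiff ℝ 1 f) : ContinuousOn (TT f) (Set.Icc (-1) 1) := by
  apply continuousOn_of_uniform_approx_of_continuousOn
  intro u hu
  obtain ⟨δ, hδ, hu⟩ := Metric.mem_uniformity_dist.1 hu
  have hpi := Real.pi_pos
  obtain ⟨p, _, h2⟩ := approx2 hf (show 0 < δ / (4 * Real.pi) by positivity)
  refine ⟨tp p, (tp_cont p).continuousOn, fun y hy => hu ?_⟩
  rw [Real.dist_eq]
  refine lt_of_le_of_lt (h2 y hy) ?_
  field_simp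
  norm_num

lemma zero_of_small {A K : ℝ} (h : ∀ ε > 0, |A| ≤ K * ε) : A = 0 := by
  by_contra hA
  have hp := abs_pos.2 hA
  have hK : 0 < K := by have := h 1 one_pos; linarith
  have := h (|A| / (2 * K)) (by positivity)
  have e : K * (|A| / (2 * K)) = |A| / 2 := by field_simp
  linarith

lemma TT_int {f : ℝ → ℝ} (hf : ContDiff ℝ 1 f) : ∫ y, TT f y ∂measureT = 0 := by
  apply zero_of_small (K := 2 * Real.pi * Real.pi)
  intro ε hε
  obtain ⟨p, _, h2⟩ := approx2 hf hε
  have := int_bound h2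
  rw [integral_sub (integrable_measureT (TT_contOn hf)) (integ (tp_cont p)), Z_zero, sub_zero] at this
  linarith

lemma TT_iso {f : ℝ → ℝ} (hf : ContDiff ℝ 1 f) (q : ℝ[X]) : ∫ y, TT f y * tp q y ∂measureT =
    Real.pi ^ 2 * ∫ y, f y * q.eval y * (1 - y ^ 2) ∂measureT := by
  rw [← sub_eq_zero]
  have hq := tp_cont q
  have hfc := hf.continuous
  obtain ⟨B, hB⟩ := bdd _ hq
  obtain ⟨B', hB'⟩ := bdd (fun y => q.eval y * (1 - y ^ 2)) (by fun_prop)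
  apply zero_of_small (K := 2 * Real.pi * B * Real.pi + Real.pi ^ 2 * (B' * Real.pi))
  intro ε hε
  obtain ⟨p, h1, h2⟩ := approx2 hf hε
  have hp := tp_cont p
  have b1 := int_bound (f := fun y => (TT f y - tp p y) * tp q y) (c := 2 * Real.pi * ε * B) (by
    intro x hx
    rw [abs_mul]
    exact mul_le_mul (h2 x hx) (hB x hx) (abs_nonneg _) (by have := Real.pi_pos; positivity))
  have b2 := int_bound (f := fun y => (f y - p.eval y) * (q.eval y * (1 - y ^ 2))) (c := ε * B') (by
    intro x hx
    rw [abs_mul]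
    exact mul_le_mul (h1 x hx) (hB' x hx) (abs_nonneg _) hε.le)
  simp only [sub_mul] at b1 b2
  rw [integral_sub (integ_mul (TT_contOn hf) hq.continuousOn)
    (integ (by fun_prop)), iso] at b1
  rw [integral_sub (integ (by fun_prop)) (integ (by fun_prop))] at b2
  simp only [← mul_assoc] at b2
  set I1 := ∫ y, TT f y * tp q y ∂measureT
  set I2 := ∫ y, p.eval y * q.eval y * (1 - y ^ 2) ∂measureT
  set I3 := ∫ y, f y * q.eval y * (1 - y ^ 2) ∂measureT
  have hpi : 0 < Real.pi ^ 2 := by have := Real.pi_pos; positivity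
  calc |I1 - Real.pi ^ 2 * I3| = |(I1 - Real.pi ^ 2 * I2) - Real.pi ^ 2 * (I3 - I2)| := by
        congr 1; ring
    _ ≤ |I1 - Real.pi ^ 2 * I2| + |Real.pi ^ 2 * (I3 - I2)| := abs_sub _ _
    _ = |I1 - Real.pi ^ 2 * I2| + Real.pi ^ 2 * |I3 - I2| := by rw [abs_mul, abs_of_pos hpi]
    _ ≤ 2 * Real.pi * ε * B * Real.pi + Real.pi ^ 2 * (ε * B' * Real.pi) := by gcongr
    _ = _ := by ring

lemma zero_of_orth {h : ℝ → ℝ} (hc : ContinuousOn h (Set.Icc (-1) 1))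
    (ho : ∀ p : ℝ[X], ∫ y, h y * p.eval y ∂measureT = 0) {x : ℝ} (hx : x ∈ Set.Icc (-1 : ℝ) 1) :
    h x = 0 := by
  have sq : ∫ y, h y * h y ∂measureT = 0 := by
    obtain ⟨B, hB⟩ := isCompact_Icc.exists_bound_of_continuousOn hc
    apply zero_of_small (K := B * Real.pi)
    intro ε hε
    obtain ⟨p, hp⟩ := exists_polynomial_near_of_continuousOn (-1) 1 h hc ε hε
    have b := int_bound (f := fun y => h y * (h y - p.eval y)) (c := B * ε) (by
      intro x hx
      rw [abs_mul]
      have := hp x hx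
      rw [abs_sub_comm] at this
      exact mul_le_mul (hB x hx) this.le (abs_nonneg _) ((norm_nonneg _).trans (hB x hx)))
    simp only [mul_sub] at b
    rw [integral_sub (integ_mul hc hc)
      (integ_mul hc p.continuous.continuousOn), ho, sub_zero] at b
    linarith
  rw [integral_measureT_eq_integral_cos] at sq
  by_contra hne
  have hcc : ContinuousOn (fun θ => h (Real.cos θ)) (Set.Icc 0 Real.pi) :=
    hc.comp Real.continuous_cos.continuousOn fun θ _ => Real.cos_mem_Icc θ
  have := intervalIntegral.integral_pos (f := fun θ => h (Real.cos θ) * h (Real.cos θ))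
    Real.pi_pos (hcc.mul hcc) (fun _ _ => mul_self_nonneg _)
    ⟨Real.arccos x, ⟨Real.arccos_nonneg x, Real.arccos_le_pi x⟩, by
      rw [Real.cos_arccos hx.1 hx.2]; exact mul_self_pos.2 hne⟩
  linarith

lemma main_id (V d : ℝ → ℝ) (ℓ : ℝ) (hV : ContDiff ℝ 2 V) (hd : Continuous d)
    (hprob : ∫ y in (-1 : ℝ)..1, d y * Real.sqrt (1 - y ^ 2) = 1)
    (hEL : ∀ x ∈ Set.Icc (-1 : ℝ) 1,
      2 * ∫ y in (-1 : ℝ)..1, Real.log |x - y| * (d y * Real.sqrt (1 - y ^ 2))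
        = V x + ℓ) {x : ℝ} (hx : x ∈ Set.Icc (-1 : ℝ) 1) :
    TT (deriv V) x = -2 * Real.pi + 2 * Real.pi ^ 2 * d x * (1 - x ^ 2) := by
  have hf : ContDiff ℝ 1 (deriv V) := by
    have : ContDiff ℝ (1 + 1) V := by simpa [one_add_one_eq_two] using hV
    exact (contDiff_succ_iff_deriv.1 this).2.2
  set h : ℝ → ℝ := fun y => TT (deriv V) y - (-2 * Real.pi + 2 * Real.pi ^ 2 * d y * (1 - y ^ 2)) with hh
  have hT := TT_contOn hf
  have hc2 : Continuous (fun y => (-2 * Real.pi + 2 * Real.pi ^ 2 * d y * (1 - y ^ 2))) := by fun_prop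
  have hc : ContinuousOn h (Set.Icc (-1) 1) := hT.sub hc2.continuousOn
  have o1 : ∫ y, h y ∂measureT = 0 := by
    rw [int_sqrt] at hprob
    have e : ∀ y, h y = TT (deriv V) y - ((-2 * Real.pi) * 1 + 2 * Real.pi ^ 2 * (d y * (1 - y ^ 2))) := by
      intro y; simp only [hh]; ring
    simp only [e]
    rw [integral_sub (integrable_measureT hT) (integ (by fun_prop)), TT_int hf,
      integral_add (integ (by fun_prop)) (integ (by fun_prop)), integral_const_mul, integral_const_mul,
      hprob, mass]
    ring
  have o2 : ∀ q : ℝ[X], ∫ y, h y * tp q y ∂measureT = 0 := by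
    intro q
    have hq := tp_cont q
    have e : ∀ y, h y * tp q y = TT (deriv V) y * tp q y -
        ((-2 * Real.pi) * tp q y + 2 * Real.pi ^ 2 * (d y * tp q y * (1 - y ^ 2))) := by
      intro y; simp only [hh]; ring
    simp only [e]
    rw [integral_sub (integ_mul hT hq.continuousOn) (integ (by fun_prop)), TT_iso hf,
      integral_add (integ (by fun_prop)) (integ (by fun_prop)), integral_const_mul, integral_const_mul,
      Z_zero, EL_int V d ℓ (hV.of_le (by norm_num)) hd hEL q]
    ring
  have := zero_of_orth hc (fun p => by
    obtain ⟨c, q, hp⟩ := surj p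
    have hq := tp_cont q
    simp only [hp, mul_add]
    rw [integral_add ((integrable_measureT hc).mul_const c)
      (integ_mul hc hq.continuousOn), integral_mul_const, o1, o2]
    ring) hx
  exact sub_eq_zero.1 this

end EqPV

theorem equilibrium_pv_identity (V d : ℝ → ℝ) (ℓ : ℝ)
    (hVanal : AnalyticOn ℝ V Set.univ)
    (hgrow_top : Tendsto (fun x : ℝ => V x / Real.log |x|) atTop atTop)
    (hgrow_bot : Tendsto (fun x : ℝ => V x / Real.log |x|) atBot atTop)
    (hd_cont : ContinuousOn d (Set.Icc (-1 : ℝ) 1))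
    (hd_pos : ∀ x ∈ Set.Icc (-1 : ℝ) 1, 0 < d x)
    (hprob : ∫ y in (-1 : ℝ)..1, d y * Real.sqrt (1 - y ^ 2) = 1)
    (hEL : ∀ x ∈ Set.Icc (-1 : ℝ) 1,
      2 * ∫ y in (-1 : ℝ)..1, Real.log |x - y| * (d y * Real.sqrt (1 - y ^ 2))
        = V x + ℓ)
    (x : ℝ) (hx : x ∈ Set.Ioo (-1 : ℝ) 1) :
    Tendsto (fun ε : ℝ =>
        (∫ lam in (-1 : ℝ)..(x - ε),
            deriv V lam * Real.sqrt (1 - lam ^ 2) / (lam - x)) +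
          ∫ lam in (x + ε)..(1 : ℝ),
            deriv V lam * Real.sqrt (1 - lam ^ 2) / (lam - x))
      (nhdsWithin 0 (Set.Ioi 0))
      (nhds (-2 * Real.pi + 2 * Real.pi ^ 2 * d x * (1 - x ^ 2))) := by
  have hV : ContDiff ℝ 2 V := by
    have := hVanal.contDiffOn (n := 2) uniqueDiffOn_univ
    exact contDiffOn_univ.1 this
  have hle : (-1 : ℝ) ≤ 1 := by norm_num
  set D : ℝ → ℝ := Set.IccExtend hle ((Set.Icc (-1 : ℝ) 1).domRestrict d) with hD
  have hDc : Continuous D := (continuousOn_iff_continuous_domRestrict.1 hd_cont).Icc_extend'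
  have hDe : ∀ y ∈ Set.Icc (-1 : ℝ) 1, D y = d y := fun y hy => by
    rw [hD, Set.IccExtend_of_mem _ _ hy]; rfl
  have hu : Set.uIcc (-1 : ℝ) 1 = Set.Icc (-1) 1 := Set.uIcc_of_le hle
  have h1 : ∫ y in (-1 : ℝ)..1, D y * Real.sqrt (1 - y ^ 2) = 1 := by
    refine Eq.trans ?_ hprob
    apply intervalIntegral.integral_congr
    intro y hy
    rw [hu] at hy
    simp only [hDe y hy]
  have h2 : ∀ x ∈ Set.Icc (-1 : ℝ) 1,
      2 * ∫ y in (-1 : ℝ)..1, Real.log |x - y| * (D y * Real.sqrt (1 - y ^ 2)) = V x + ℓ := by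
    intro x hx
    rw [← hEL x hx]
    congr 1
    apply intervalIntegral.integral_congr
    intro y hy
    rw [hu] at hy
    simp only [hDe y hy]
  have hx' := Set.Ioo_subset_Icc_self hx
  rw [← hDe x hx', ← EqPV.main_id V D ℓ hV hDc h1 h2 hx']
  apply EqPV.PV _ hx
  have : ContDiff ℝ (1 + 1) V := by simpa [one_add_one_eq_two] using hV
  exact ((contDiff_succ_iff_deriv.1 this).2.2).differentiable (by norm_num)
end
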